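/- arXiv:0907.1274 — 5 statements merged into one kernel-verified Lean document; each statement's English description precedes it below -/
import Mathlib

section
/- Let T>0, and let ρ0∈L¹(0,1) and u∈L¹(0,T) be nonnegative almost everywhere. Then the Cauchy problem ∂_tρ+∂_x(λ(W(t))ρ)=0, W(t)=∫₀¹ρ(t,x)dx, with initial condition ρ(0,·)=ρ0 and boundary condition λ(W(t))ρ(t,0)=u(t), admits a unique weak solution ρ∈C⁰([0,T];L¹(0,1)), and this weak solution is nonnegative almost everywhere on [0,T]×[0,1]. -/
open MeasureTheory Set

noncomputable section

/-- A weak solution of the Cauchy problem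
`∂_t ρ + ∂_x (λ(W(t)) ρ) = 0`, `W(t) = ∫₀¹ ρ(t,x) dx`,
with initial datum `ρ(0,·) = ρ₀` and boundary datum `λ(W(t)) ρ(t,0) = u(t)`. -/
def IsWeakSolution (lam : ℝ → ℝ) (T : ℝ) (ρ₀ u : ℝ → ℝ) (ρ : ℝ → ℝ → ℝ) : Prop :=
  (∀ t ∈ Set.Icc (0:ℝ) T, MeasureTheory.IntegrableOn (ρ t) (Set.Ioc 0 1)) ∧
  (∀ t ∈ Set.Icc (0:ℝ) T, ∀ ε > (0:ℝ), ∃ η > (0:ℝ), ∀ s ∈ Set.Icc (0:ℝ) T,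
      |s - t| < η → (∫ x in Set.Ioc (0:ℝ) 1, |ρ s x - ρ t x|) < ε) ∧
  (∀ τ ∈ Set.Icc (0:ℝ) T, ∀ φ : ℝ → ℝ → ℝ,
      ContDiff ℝ 1 (Function.uncurry φ) →
      (∀ x ∈ Set.Icc (0:ℝ) 1, φ τ x = 0) →
      (∀ t ∈ Set.Icc (0:ℝ) τ, φ t 1 = 0) →
      (∫ t in Set.Ioc (0:ℝ) τ, ∫ x in Set.Ioc (0:ℝ) 1,
          ρ t x * (deriv (fun s => φ s x) t
            + lam (∫ y in Set.Ioc (0:ℝ) 1, ρ t y) * deriv (φ t) x))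
        + (∫ t in Set.Ioc (0:ℝ) τ, u t * φ t 0)
        + (∫ x in Set.Ioc (0:ℝ) 1, ρ₀ x * φ 0 x) = 0)

/-- `ξ` is increasing with all difference quotients in `[m, M]`. -/
def HasSlopesIn (m M : ℝ) (ξ : ℝ → ℝ) : Prop :=
  ∀ s t, s ≤ t → m * (t - s) ≤ ξ t - ξ s ∧ ξ t - ξ s ≤ M * (t - s)

namespace HasSlopesIn

variable {m M : ℝ} {ξ : ℝ → ℝ}

lemma abs_sub_le (h : HasSlopesIn m M ξ) (hm : 0 < m) (s t : ℝ) :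
    |ξ s - ξ t| ≤ M * |s - t| := by
  rcases le_total s t with hst | hst
  · have := h s t hst
    rw [abs_sub_comm, abs_sub_comm s, abs_of_nonneg (sub_nonneg.2 hst), abs_of_nonneg]
    · exact this.2
    · nlinarith
  · have := h t s hst
    rw [abs_of_nonneg (sub_nonneg.2 hst), abs_of_nonneg]
    · exact this.2
    · nlinarith

lemma le_abs_sub (h : HasSlopesIn m M ξ) (s t : ℝ) :
    m * |s - t| ≤ |ξ s - ξ t| := by
  rcases le_total s t with hst | hst
  · rw [abs_sub_comm, abs_sub_comm (ξ s), abs_of_nonneg (sub_nonneg.2 hst)]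
    exact (h s t hst).1.trans (le_abs_self _)
  · rw [abs_of_nonneg (sub_nonneg.2 hst)]
    exact (h t s hst).1.trans (le_abs_self _)

lemma nonneg (h : HasSlopesIn m M ξ) (hm : 0 < m) : 0 ≤ M := by
  have := h 0 1 zero_le_one
  linarith [this.1, this.2]

lemma pos (h : HasSlopesIn m M ξ) (hm : 0 < m) : 0 < M := by
  have := h 0 1 zero_le_one
  linarith [this.1, this.2]

lemma continuous (h : HasSlopesIn m M ξ) (hm : 0 < m) : Continuous ξ := by
  have : LipschitzWith ⟨M, h.nonneg hm⟩ ξ :=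
    LipschitzWith.of_dist_le_mul fun x y => by
      rw [Real.dist_eq, Real.dist_eq]
      exact h.abs_sub_le hm x y
  exact this.continuous

lemma strictMono (h : HasSlopesIn m M ξ) (hm : 0 < m) : StrictMono ξ := fun s t hst => by
  have := (h s t hst.le).1
  nlinarith [mul_pos hm (sub_pos.2 hst)]

lemma surjective (h : HasSlopesIn m M ξ) (hm : 0 < m) : Function.Surjective ξ := by
  refine (h.continuous hm).surjective ?_ ?_
  · have h1 : Filter.Tendsto (fun t : ℝ => m * t + ξ 0) Filter.atTop Filter.atTop :=
      Filter.tendsto_atTop_add_const_right _ _ (Filter.tendsto_id.const_mul_atTop hm)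
    refine Filter.tendsto_atTop_mono' _ ?_ h1
    filter_upwards [Filter.eventually_ge_atTop 0] with t ht
    linarith [(h 0 t ht).1]
  · have h1 : Filter.Tendsto (fun t : ℝ => m * t + ξ 0) Filter.atBot Filter.atBot :=
      Filter.tendsto_atBot_add_const_right _ _ (Filter.tendsto_id.const_mul_atBot hm)
    refine Filter.tendsto_atBot_mono' _ ?_ h1
    filter_upwards [Filter.eventually_le_atBot 0] with t ht
    linarith [(h t 0 ht).1]

lemma apply_invFun (h : HasSlopesIn m M ξ) (hm : 0 < m) (z : ℝ) :
    ξ (Function.invFun ξ z) = z :=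
  Function.rightInverse_invFun (h.surjective hm) z

lemma invFun_apply (h : HasSlopesIn m M ξ) (hm : 0 < m) (t : ℝ) :
    Function.invFun ξ (ξ t) = t :=
  Function.leftInverse_invFun (h.strictMono hm).injective t

lemma le_invFun_iff (h : HasSlopesIn m M ξ) (hm : 0 < m) (t z : ℝ) :
    t ≤ Function.invFun ξ z ↔ ξ t ≤ z := by
  rw [← (h.strictMono hm).le_iff_le, h.apply_invFun hm]

lemma invFun (h : HasSlopesIn m M ξ) (hm : 0 < m) :
    HasSlopesIn M⁻¹ m⁻¹ (Function.invFun ξ) := by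
  intro s t hst
  have hM := h.pos hm
  have hle : Function.invFun ξ s ≤ Function.invFun ξ t := by
    rwa [h.le_invFun_iff hm, h.apply_invFun hm]
  have := h _ _ hle
  rw [h.apply_invFun hm, h.apply_invFun hm] at this
  constructor
  · rw [inv_mul_le_iff₀ hM]; exact this.2
  · rw [le_inv_mul_iff₀ hm]; exact this.1

end HasSlopesIn

/-- The entrance time of the particle which leaves the unit interval at time `s`, when particles
move along `t ↦ ξ t - z`. -/
def exitLabel (ξ : ℝ → ℝ) (s : ℝ) : ℝ := Function.invFun ξ (ξ s - 1)

lemma HasSlopesIn.apply_exitLabel {m M : ℝ} {ξ : ℝ → ℝ} (h : HasSlopesIn m M ξ) (hm : 0 < m)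
    (s : ℝ) : ξ (exitLabel ξ s) = ξ s - 1 := h.apply_invFun hm _

lemma HasSlopesIn.exitLabel_le {m M : ℝ} {ξ : ℝ → ℝ} (h : HasSlopesIn m M ξ) (hm : 0 < m)
    (s : ℝ) : exitLabel ξ s ≤ s := by
  rw [← (h.strictMono hm).le_iff_le, h.apply_exitLabel hm]; linarith

lemma HasSlopesIn.exitLabel {m M : ℝ} {ξ : ℝ → ℝ} (h : HasSlopesIn m M ξ) (hm : 0 < m) :
    HasSlopesIn (m / M) (M / m) (exitLabel ξ) := by
  intro s t hst
  have hM := h.pos hm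
  have h1 := h s t hst
  have h2 := h.invFun hm (ξ s - 1) (ξ t - 1) (by nlinarith)
  simp only [sub_sub_sub_cancel_right] at h2
  constructor
  · refine le_trans ?_ h2.1
    rw [div_mul_eq_mul_div, div_eq_inv_mul]
    gcongr
    exact h1.1
  · refine h2.2.trans ?_
    rw [div_mul_eq_mul_div, div_eq_inv_mul]
    gcongr
    exact h1.2

/-- Position at time `t` of a particle entering at time `0`, moving with velocity `a` for positive
times and with unit velocity for negative times. -/
def front (a : ℝ → ℝ) (t : ℝ) : ℝ := ∫ s in (0:ℝ)..t, if s ≤ 0 then 1 else a s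

lemma measurable_frontVelocity {a : ℝ → ℝ} (ha : Measurable a) :
    Measurable fun s : ℝ => if s ≤ 0 then 1 else a s :=
  Measurable.ite measurableSet_Iic measurable_const ha

lemma intervalIntegrable_frontVelocity {a : ℝ → ℝ} (ha : Continuous a) (s t : ℝ) :
    IntervalIntegrable (fun s : ℝ => if s ≤ 0 then 1 else a s) volume s t := by
  have h1 : IntervalIntegrable (fun s : ℝ => 1 + |a s|) volume s t :=
    (continuous_const.add ha.abs).intervalIntegrable _ _
  refine h1.mono_fun (measurable_frontVelocity ha.measurable).aestronglyMeasurable ?_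
  refine Filter.Eventually.of_forall fun r => ?_
  simp only [Real.norm_eq_abs]
  rw [abs_of_nonneg (by positivity : 0 ≤ 1 + |a r|)]
  split_ifs
  · simp
  · linarith

lemma front_of_nonpos {a : ℝ → ℝ} {t : ℝ} (ht : t ≤ 0) : front a t = t := by
  have : EqOn (fun s : ℝ => if s ≤ 0 then 1 else a s) (fun _ => 1) (uIcc 0 t) := by
    intro s hs
    rw [uIcc_of_ge ht] at hs
    simp [hs.2]
  rw [front, intervalIntegral.integral_congr this]
  simp

lemma front_of_nonneg {a : ℝ → ℝ} {t : ℝ} (ht : 0 ≤ t) : front a t = ∫ s in (0:ℝ)..t, a s := by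
  rw [front, intervalIntegral.integral_of_le ht, intervalIntegral.integral_of_le ht]
  refine setIntegral_congr_fun measurableSet_Ioc fun s hs => ?_
  simp [hs.1]

lemma front_hasSlopesIn {a : ℝ → ℝ} (ha : Continuous a) {m M : ℝ} (hm1 : m ≤ 1) (hM1 : 1 ≤ M)
    (hm : ∀ t, m ≤ a t) (hM : ∀ t, a t ≤ M) : HasSlopesIn m M (front a) := by
  intro s t hst
  have hint := intervalIntegrable_frontVelocity ha
  have key : front a t - front a s = ∫ r in s..t, if r ≤ 0 then 1 else a r :=
    intervalIntegral.integral_interval_sub_left (hint _ _) (hint _ _)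
  rw [key]
  constructor
  · have := intervalIntegral.integral_mono_on (f := fun _ => m) hst (by simp) (hint s t)
      (fun r _ => by split_ifs; exacts [hm1, hm r])
    simpa [mul_comm] using this
  · have := intervalIntegral.integral_mono_on (g := fun _ => M) hst (hint s t) (by simp)
      (fun r _ => by split_ifs; exacts [hM1, hM r])
    simpa [mul_comm] using this

lemma hasDerivAt_front {a : ℝ → ℝ} (ha : Continuous a) {t : ℝ} (ht : t ≠ 0) :
    HasDerivAt (front a) (if t ≤ 0 then 1 else a t) t := by
  refine intervalIntegral.integral_hasDerivAt_right (intervalIntegrable_frontVelocity ha _ _)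
    ((measurable_frontVelocity ha.measurable).stronglyMeasurable.stronglyMeasurableAtFilter) ?_
  rcases lt_or_gt_of_ne ht with h | h
  · refine ContinuousAt.congr (f := fun _ => 1) continuousAt_const ?_
    filter_upwards [Iio_mem_nhds h] with s hs
    simp [(mem_Iio.1 hs).le]
  · refine ContinuousAt.congr (f := a) ha.continuousAt ?_
    filter_upwards [Ioi_mem_nhds h] with s hs
    simp [mem_Ioi.1 hs]

lemma monotone_primitive {β : ℝ → ℝ} (hβ : Integrable β) (h0 : ∀ r, 0 ≤ β r) :
    Monotone fun r => ∫ s in (0:ℝ)..r, β s := by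
  intro s t hst
  have key : (∫ r in (0:ℝ)..t, β r) - (∫ r in (0:ℝ)..s, β r) = ∫ r in s..t, β r :=
    intervalIntegral.integral_interval_sub_left hβ.intervalIntegrable hβ.intervalIntegrable
  have := intervalIntegral.integral_nonneg (μ := volume) hst fun r _ => h0 r
  simp only
  linarith

lemma primitive_sub_le {β : ℝ → ℝ} (hβ : Integrable β) (h0 : ∀ r, 0 ≤ β r) (s t : ℝ) :
    (∫ r in (0:ℝ)..t, β r) - (∫ r in (0:ℝ)..s, β r) ≤ ∫ r, β r := by
  rcases le_total s t with hst | hst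
  · rw [intervalIntegral.integral_interval_sub_left hβ.intervalIntegrable hβ.intervalIntegrable,
      intervalIntegral.integral_of_le hst]
    exact setIntegral_le_integral hβ (Filter.Eventually.of_forall h0)
  · have h1 := monotone_primitive hβ h0 hst
    have h2 : 0 ≤ ∫ r, β r := integral_nonneg h0
    simp only at h1
    linarith

/-- A nonnegative integrable function is the sum of a bounded one and one with small integral. -/
lemma exists_primitive_decomposition {α : ℝ → ℝ} (hα : Integrable α) (h0 : ∀ r, 0 ≤ α r)
    {ε : ℝ} (hε : 0 < ε) :
    ∃ B : ℝ, 0 ≤ B ∧ ∃ F G : ℝ → ℝ, (∀ r, ∫ s in (0:ℝ)..r, α s = F r + G r) ∧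
      (∀ r s, |F r - F s| ≤ B * |r - s|) ∧ Monotone G ∧ ∀ r s, G r - G s ≤ ε := by
  have hint : ∀ n : ℕ, Integrable fun r => max (α r - n) 0 := by
    intro n
    refine hα.mono ((hα.aestronglyMeasurable.sub aestronglyMeasurable_const).sup
      aestronglyMeasurable_const) (Filter.Eventually.of_forall fun r => ?_)
    rw [Real.norm_eq_abs, Real.norm_eq_abs, abs_of_nonneg (le_max_right _ _),
      abs_of_nonneg (h0 r)]
    exact max_le (by linarith [(Nat.cast_nonneg n : (0:ℝ) ≤ n)]) (h0 r)
  have hlim : Filter.Tendsto (fun n : ℕ => ∫ r, max (α r - n) 0) Filter.atTop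
      (nhds (∫ _ : ℝ, (0:ℝ))) := by
    refine tendsto_integral_of_dominated_convergence α
      (fun n => (hint n).aestronglyMeasurable) hα (fun n => ?_) ?_
    · refine Filter.Eventually.of_forall fun r => ?_
      rw [Real.norm_eq_abs, abs_of_nonneg (le_max_right _ _)]
      exact max_le (by linarith [(Nat.cast_nonneg n : (0:ℝ) ≤ n)]) (h0 r)
    · refine Filter.Eventually.of_forall fun r => ?_
      refine tendsto_const_nhds.congr' ?_
      obtain ⟨k, hk⟩ := exists_nat_ge (α r)
      filter_upwards [Filter.eventually_ge_atTop k] with n hn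
      have : (k:ℝ) ≤ n := by exact_mod_cast hn
      rw [max_eq_right]
      linarith
  rw [integral_zero] at hlim
  obtain ⟨n, hn⟩ := (hlim.eventually (gt_mem_nhds hε)).exists
  have hint' : Integrable fun r => α r - max (α r - n) 0 := hα.sub (hint n)
  refine ⟨n, n.cast_nonneg, fun r => ∫ s in (0:ℝ)..r, (α s - max (α s - n) 0),
    fun r => ∫ s in (0:ℝ)..r, max (α s - n) 0, fun r => ?_, fun r s => ?_,
    monotone_primitive (hint n) fun r => le_max_right _ _, fun r s => ?_⟩
  · rw [← intervalIntegral.integral_add hint'.intervalIntegrable (hint n).intervalIntegrable]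
    simp
  · simp only
    rw [intervalIntegral.integral_interval_sub_left hint'.intervalIntegrable
      hint'.intervalIntegrable, ← Real.norm_eq_abs]
    refine intervalIntegral.norm_integral_le_of_norm_le_const fun x _ => ?_
    rw [Real.norm_eq_abs, abs_of_nonneg]
    · linarith [le_max_left (α x - n) 0]
    · have := h0 x
      rw [sub_nonneg]
      exact max_le (by linarith [(Nat.cast_nonneg n : (0:ℝ) ≤ n)]) (h0 x)
  · exact (primitive_sub_le (hint n) (fun r => le_max_right _ _) s r).trans hn.le

lemma abs_exitLabel_sub_le {m M : ℝ} (hm : 0 < m) {ξ₁ ξ₂ : ℝ → ℝ} (h₁ : HasSlopesIn m M ξ₁)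
    (h₂ : HasSlopesIn m M ξ₂) {d s : ℝ} (hd : ∀ r ≤ s, |ξ₁ r - ξ₂ r| ≤ d) :
    |exitLabel ξ₁ s - exitLabel ξ₂ s| ≤ 2 * d / m := by
  rw [le_div_iff₀ hm, mul_comm]
  refine (h₁.le_abs_sub _ _).trans ?_
  rw [h₁.apply_exitLabel hm]
  have e : ξ₁ s - 1 - ξ₁ (exitLabel ξ₂ s) =
      (ξ₁ s - ξ₂ s) - (ξ₁ (exitLabel ξ₂ s) - ξ₂ (exitLabel ξ₂ s)) := by
    rw [h₂.apply_exitLabel hm]; ring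
  rw [e]
  refine (abs_sub _ _).trans ?_
  linarith [hd s le_rfl, hd _ (h₂.exitLabel_le hm s)]

/-- A monotone function of total variation at most `ε`, composed with two nearby bi-Lipschitz maps,
changes little in the mean. -/
lemma integral_abs_monotone_comp_sub_le {m M : ℝ} (hm : 0 < m) {ζ₁ ζ₂ G : ℝ → ℝ}
    (h₁ : HasSlopesIn m M ζ₁) (h₂ : Measurable ζ₂) (hG : Monotone G) {ε : ℝ}
    (hGε : ∀ r s, G r - G s ≤ ε) {d t : ℝ} (hd0 : 0 ≤ d) (ht : 0 ≤ t)
    (hd : ∀ s ∈ Icc 0 t, |ζ₁ s - ζ₂ s| ≤ d) :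
    IntervalIntegrable (fun s => |G (ζ₁ s) - G (ζ₂ s)|) volume 0 t ∧
    ∫ s in (0:ℝ)..t, |G (ζ₁ s) - G (ζ₂ s)| ≤ 2 * d / m * ε := by
  have hε : 0 ≤ ε := by simpa using hGε 0 0
  have hmono : Monotone fun s => G (ζ₁ s) := hG.comp (h₁.strictMono hm).monotone
  have hI : ∀ a b, IntervalIntegrable (fun s => G (ζ₁ s)) volume a b :=
    fun a b => (hmono.monotoneOn _).intervalIntegrable
  have hImeas : Measurable fun s => |G (ζ₁ s) - G (ζ₂ s)| := by
    have := (hmono.measurable.sub (hG.measurable.comp h₂)).norm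
    exact this
  have hII : IntervalIntegrable (fun s => |G (ζ₁ s) - G (ζ₂ s)|) volume 0 t := by
    refine (intervalIntegrable_const (c := ε)).mono_fun hImeas.aestronglyMeasurable ?_
    refine Filter.Eventually.of_forall fun s => ?_
    simp only [Real.norm_eq_abs, abs_abs]
    rw [abs_of_nonneg hε]
    exact abs_sub_le_iff.2 ⟨hGε _ _, hGε _ _⟩
  refine ⟨hII, ?_⟩
  set e := d / m with he
  have he0 : 0 ≤ e := by positivity
  have hme : m * e = d := by rw [he]; field_simp
  have hIadd : ∀ c : ℝ, IntervalIntegrable (fun s => G (ζ₁ (s + c))) volume 0 t := fun c =>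
    ((hmono.comp (monotone_id.add_const c)).monotoneOn _).intervalIntegrable
  have hpt : ∀ s ∈ Icc 0 t, |G (ζ₁ s) - G (ζ₂ s)| ≤ G (ζ₁ (s + e)) - G (ζ₁ (s + -e)) := by
    intro s hs
    have h3 := (h₁ s (s + e) (by linarith)).1
    have h4 := (h₁ (s + -e) s (by linarith)).1
    have h5 := abs_sub_le_iff.1 (hd s hs)
    have e1 : m * (s + e - s) = d := by rw [← hme]; ring
    have e2 : m * (s - (s + -e)) = d := by rw [← hme]; ring
    have g1 : G (ζ₁ s) ≤ G (ζ₁ (s + e)) := hG (by linarith)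
    have g2 : G (ζ₁ (s + -e)) ≤ G (ζ₁ s) := hG (by linarith)
    have g3 : G (ζ₂ s) ≤ G (ζ₁ (s + e)) := hG (by linarith)
    have g4 : G (ζ₁ (s + -e)) ≤ G (ζ₂ s) := hG (by linarith)
    exact abs_sub_le_iff.2 ⟨by linarith, by linarith⟩
  refine (intervalIntegral.integral_mono_on ht hII ((hIadd e).sub (hIadd (-e))) hpt).trans ?_
  rw [intervalIntegral.integral_sub (hIadd e) (hIadd (-e)),
    intervalIntegral.integral_comp_add_right (fun s => G (ζ₁ s)),
    intervalIntegral.integral_comp_add_right (fun s => G (ζ₁ s))]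
  have e3 : (∫ s in (0 + e)..(t + e), G (ζ₁ s)) - (∫ s in (0 + -e)..(t + -e), G (ζ₁ s)) =
      (∫ s in (t + -e)..(t + e), G (ζ₁ s)) - ∫ s in (0 + -e)..(0 + e), G (ζ₁ s) := by
    have i1 := intervalIntegral.integral_add_adjacent_intervals (hI (0 + -e) (0 + e))
      (hI (0 + e) (t + e))
    have i2 := intervalIntegral.integral_add_adjacent_intervals (hI (0 + -e) (t + -e))
      (hI (t + -e) (t + e))
    linarith
  rw [e3]
  have u1 := intervalIntegral.integral_mono_on (by linarith : t + -e ≤ t + e) (hI _ _)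
    (intervalIntegrable_const (c := G (ζ₁ (t + e)))) fun s hs => hmono hs.2
  have u2 := intervalIntegral.integral_mono_on (by linarith : 0 + -e ≤ 0 + e)
    (intervalIntegrable_const (c := G (ζ₁ (0 + -e)))) (hI _ _) fun s hs => hmono hs.1
  rw [intervalIntegral.integral_const, smul_eq_mul] at u1 u2
  have u3 := hGε (ζ₁ (t + e)) (ζ₁ (0 + -e))
  have e4 : 2 * d / m = 2 * e := by rw [he]; ring
  rw [e4]
  nlinarith

/-- Bielecki-type contraction estimate for the total outflow. -/
lemma exists_contraction_weight {α : ℝ → ℝ} (hα : Integrable α) (h0 : ∀ r, 0 ≤ α r)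
    {m M κ : ℝ} (hm : 0 < m) (hM : 0 < M) (hκ : 0 < κ) :
    ∃ K : ℝ, 0 < K ∧ ∀ ξ₁ ξ₂ : ℝ → ℝ, HasSlopesIn m M ξ₁ → HasSlopesIn m M ξ₂ →
      ∀ N t : ℝ, 0 ≤ N → 0 ≤ t → (∀ s ≤ t, |ξ₁ s - ξ₂ s| ≤ N * Real.exp (K * s)) →
      ∫ s in (0:ℝ)..t, |(∫ r in (0:ℝ)..exitLabel ξ₁ s, α r) - ∫ r in (0:ℝ)..exitLabel ξ₂ s, α r|
        ≤ κ * N * Real.exp (K * t) := by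
  set ε : ℝ := κ * m ^ 2 / (8 * M) with hε
  obtain ⟨B, hB, F, G, hFG, hF, hGmono, hGε⟩ :=
    exists_primitive_decomposition hα h0 (ε := ε) (by positivity)
  refine ⟨4 * (B + 1) / (m * κ), by positivity, ?_⟩
  set K := 4 * (B + 1) / (m * κ) with hK
  have hK0 : 0 < K := by positivity
  intro ξ₁ ξ₂ h₁ h₂ N t hN ht hd
  have hz : ∀ s ≤ t, |exitLabel ξ₁ s - exitLabel ξ₂ s| ≤ 2 * (N * Real.exp (K * s)) / m := by
    intro s hs
    refine abs_exitLabel_sub_le hm h₁ h₂ fun r hr => (hd r (hr.trans hs)).trans ?_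
    gcongr
  have hG2 := integral_abs_monotone_comp_sub_le (d := 2 * (N * Real.exp (K * t)) / m) (t := t)
    (by positivity) (h₁.exitLabel hm)
    (((h₂.exitLabel hm).continuous (by positivity)).measurable) hGmono hGε (by positivity) ht
    (fun s hs => (hz s hs.2).trans (by gcongr; exact hs.2))
  have hFc : Continuous F := by
    have : LipschitzWith ⟨B, hB⟩ F := LipschitzWith.of_dist_le_mul fun x y => by
      rw [Real.dist_eq, Real.dist_eq]
      exact hF x y
    exact this.continuous
  have c1 := (h₁.exitLabel hm).continuous (by positivity)
  have c2 := (h₂.exitLabel hm).continuous (by positivity)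
  have hAc : Continuous fun r => ∫ s in (0:ℝ)..r, α s :=
    intervalIntegral.continuous_primitive (fun _ _ => hα.intervalIntegrable) 0
  have hexp : Continuous fun s => B * (2 * (N * Real.exp (K * s)) / m) := by fun_prop
  have hpt : ∀ s ∈ Icc 0 t,
      |(∫ r in (0:ℝ)..exitLabel ξ₁ s, α r) - ∫ r in (0:ℝ)..exitLabel ξ₂ s, α r| ≤
      B * (2 * (N * Real.exp (K * s)) / m) +
        |G (exitLabel ξ₁ s) - G (exitLabel ξ₂ s)| := by
    intro s hs
    rw [hFG, hFG, add_sub_add_comm]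
    refine (abs_add_le _ _).trans (add_le_add_left ((hF _ _).trans ?_) _)
    exact mul_le_mul_of_nonneg_left (hz s hs.2) hB
  have hcomp := intervalIntegral.integral_mono_on ht
    ((((hAc.comp c1).sub (hAc.comp c2)).abs).intervalIntegrable 0 t)
    ((hexp.intervalIntegrable 0 t).add hG2.1) hpt
  refine hcomp.trans ?_
  rw [intervalIntegral.integral_add (hexp.intervalIntegrable 0 t) hG2.1]
  have hE : ∫ s in (0:ℝ)..t, B * (2 * (N * Real.exp (K * s)) / m) =
      B * (2 * N / m) * ((Real.exp (K * t) - 1) / K) := by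
    have hder : ∀ s ∈ uIcc 0 t, HasDerivAt
        (fun s => B * (2 * N / m) * ((Real.exp (K * s) - 1) / K))
        (B * (2 * (N * Real.exp (K * s)) / m)) s := by
      intro s _
      have d1 : HasDerivAt (fun s => Real.exp (K * s)) (Real.exp (K * s) * (K * 1)) s :=
        ((hasDerivAt_id s).const_mul K).exp
      refine (((d1.sub_const 1).div_const K).const_mul (B * (2 * N / m))).congr_deriv ?_
      have hKne := hK0.ne'
      clear_value K
      field_simp
    rw [intervalIntegral.integral_eq_sub_of_hasDerivAt hder (hexp.intervalIntegrable 0 t)]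
    simp
  rw [hE]
  have b1 : B * (2 * N / m) * ((Real.exp (K * t) - 1) / K) ≤ κ / 2 * N * Real.exp (K * t) := by
    have : B * (2 * N / m) * ((Real.exp (K * t) - 1) / K) =
        B / (B + 1) * (κ / 2 * N * (Real.exp (K * t) - 1)) := by
      rw [hK]; field_simp; ring
    rw [this]
    have q : B / (B + 1) ≤ 1 := by rw [div_le_one (by positivity)]; linarith
    have e1 : 1 ≤ Real.exp (K * t) := Real.one_le_exp (by positivity)
    calc B / (B + 1) * (κ / 2 * N * (Real.exp (K * t) - 1))
        ≤ 1 * (κ / 2 * N * (Real.exp (K * t) - 1)) :=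
          mul_le_mul_of_nonneg_right q (mul_nonneg (by positivity) (by linarith))
      _ ≤ κ / 2 * N * Real.exp (K * t) := by
          rw [one_mul]
          exact mul_le_mul_of_nonneg_left (by linarith) (by positivity)
  have b2 : 2 * (2 * (N * Real.exp (K * t)) / m) / (m / M) * ε = κ / 2 * N * Real.exp (K * t) := by
    rw [hε]; field_simp; ring
  rw [b2] at hG2
  linarith [hG2.2]

/-- The velocity of the flow driven by the mass between the exit and the entrance. -/
def flowVelocity (lam α ξ : ℝ → ℝ) (s : ℝ) : ℝ :=
  lam ((∫ r in (0:ℝ)..s, α r) - ∫ r in (0:ℝ)..exitLabel ξ s, α r)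

lemma continuous_flowVelocity {lam α ξ : ℝ → ℝ} (hlam : Continuous lam) (hα : Integrable α)
    {m M : ℝ} (hm : 0 < m) (hξ : HasSlopesIn m M ξ) : Continuous (flowVelocity lam α ξ) := by
  have hAc : Continuous fun r => ∫ s in (0:ℝ)..r, α s :=
    intervalIntegral.continuous_primitive (fun _ _ => hα.intervalIntegrable) 0
  have hM := hξ.pos hm
  exact hlam.comp (hAc.sub (hAc.comp ((hξ.exitLabel hm).continuous (by positivity))))

section FixedPoint

variable {lam α : ℝ → ℝ} {m M : ℝ}

lemma exists_front_contraction (hlam : Continuous lam) {L : ℝ} (hL0 : 0 ≤ L)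
    (hL : ∀ x y, |lam x - lam y| ≤ L * |x - y|)
    (hα : Integrable α) (h0 : ∀ r, 0 ≤ α r) (hm : 0 < m) (hM : 0 < M) :
    ∃ K : ℝ, 0 < K ∧ ∀ ξ₁ ξ₂ : ℝ → ℝ, HasSlopesIn m M ξ₁ → HasSlopesIn m M ξ₂ →
      ∀ N t : ℝ, 0 ≤ N → (∀ s ≤ t, |ξ₁ s - ξ₂ s| ≤ N * Real.exp (K * s)) →
      |front (flowVelocity lam α ξ₁) t - front (flowVelocity lam α ξ₂) t| ≤
        N / 2 * Real.exp (K * t) := by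
  obtain ⟨K, hK, hcontr⟩ := exists_contraction_weight hα h0 hm hM
    (κ := 1 / (2 * (L + 1))) (by positivity)
  refine ⟨K, hK, fun ξ₁ ξ₂ h₁ h₂ N t hN hd => ?_⟩
  rcases le_total t 0 with ht | ht
  · rw [front_of_nonpos ht, front_of_nonpos ht, sub_self, abs_zero]
    positivity
  have c1 := continuous_flowVelocity hlam hα hm h₁
  have c2 := continuous_flowVelocity hlam hα hm h₂
  rw [front_of_nonneg ht, front_of_nonneg ht,
    ← intervalIntegral.integral_sub (c1.intervalIntegrable _ _) (c2.intervalIntegrable _ _)]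
  refine (intervalIntegral.abs_integral_le_integral_abs ht).trans ?_
  have hAc : Continuous fun r => ∫ s in (0:ℝ)..r, α s :=
    intervalIntegral.continuous_primitive (fun _ _ => hα.intervalIntegrable) 0
  have d1 := (h₁.exitLabel hm).continuous (by positivity)
  have d2 := (h₂.exitLabel hm).continuous (by positivity)
  have c3 : Continuous fun s => L * |(∫ r in (0:ℝ)..exitLabel ξ₁ s, α r) -
      ∫ r in (0:ℝ)..exitLabel ξ₂ s, α r| :=
    continuous_const.mul ((hAc.comp d1).sub (hAc.comp d2)).abs
  have hle := intervalIntegral.integral_mono_on (μ := volume) ht ((c1.sub c2).abs.intervalIntegrable 0 t)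
    (c3.intervalIntegrable 0 t) (fun s _ => by
      refine (hL _ _).trans (le_of_eq ?_)
      rw [sub_sub_sub_cancel_left, abs_sub_comm])
  refine hle.trans ?_
  rw [intervalIntegral.integral_const_mul]
  have hc := hcontr ξ₁ ξ₂ h₁ h₂ N t hN ht hd
  refine (mul_le_mul_of_nonneg_left hc hL0).trans ?_
  have e : L * (1 / (2 * (L + 1)) * N * Real.exp (K * t)) =
      L / (L + 1) * (N / 2 * Real.exp (K * t)) := by field_simp
  rw [e]
  have q : L / (L + 1) ≤ 1 := by rw [div_le_one (by positivity)]; linarith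
  calc _ ≤ 1 * (N / 2 * Real.exp (K * t)) := mul_le_mul_of_nonneg_right q (by positivity)
    _ = _ := one_mul _

lemma HasSlopesIn.le_mul_exp {ξ₁ ξ₂ : ℝ → ℝ} (h₁ : HasSlopesIn m M ξ₁)
    (h₂ : HasSlopesIn m M ξ₂) (hm : 0 < m) (hid : ∀ t ≤ 0, ξ₁ t = ξ₂ t) {K : ℝ} (hK : 0 < K)
    (t : ℝ) : |ξ₁ t - ξ₂ t| ≤ M / K * Real.exp (K * t) := by
  have hM := h₁.pos hm
  rcases le_total t 0 with ht | ht
  · rw [hid t ht, sub_self, abs_zero]; positivity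
  have e1 := h₁ 0 t ht
  have e2 := h₂ 0 t ht
  have e0 := hid 0 le_rfl
  have hmt : 0 ≤ m * (t - 0) := mul_nonneg hm.le (by linarith)
  have e3 : |ξ₁ t - ξ₂ t| ≤ M * t := abs_sub_le_iff.2 ⟨by linarith, by linarith⟩
  have e4 := Real.add_one_le_exp (K * t)
  calc |ξ₁ t - ξ₂ t| ≤ M * t := e3
    _ = M / K * (K * t) := by field_simp
    _ ≤ M / K * Real.exp (K * t) := by gcongr; linarith

theorem front_flowVelocity_unique (hlam : Continuous lam) {L : ℝ} (hL0 : 0 ≤ L)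
    (hL : ∀ x y, |lam x - lam y| ≤ L * |x - y|)
    (hα : Integrable α) (h0 : ∀ r, 0 ≤ α r) (hm : 0 < m) {ξ₁ ξ₂ : ℝ → ℝ}
    (h₁ : HasSlopesIn m M ξ₁) (h₂ : HasSlopesIn m M ξ₂) {T : ℝ}
    (e₁ : ∀ t ≤ T, front (flowVelocity lam α ξ₁) t = ξ₁ t)
    (e₂ : ∀ t ≤ T, front (flowVelocity lam α ξ₂) t = ξ₂ t)
    (hid : ∀ t ≤ 0, ξ₁ t = ξ₂ t) :
    ∀ t ≤ T, ξ₁ t = ξ₂ t := by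
  have hM := h₁.pos hm
  obtain ⟨K, hK, hcontr⟩ := exists_front_contraction hlam hL0 hL hα h0 hm hM
  have key : ∀ n : ℕ, ∀ t ≤ T, |ξ₁ t - ξ₂ t| ≤ (M / K) * (1 / 2) ^ n * Real.exp (K * t) := by
    intro n
    induction n with
    | zero => intro t _; simpa using h₁.le_mul_exp h₂ hm hid hK t
    | succ n ih =>
      intro t ht
      have := hcontr ξ₁ ξ₂ h₁ h₂ _ t (by positivity) (fun s hs => ih s (hs.trans ht))
      rw [e₁ t ht, e₂ t ht] at this
      refine this.trans (le_of_eq ?_)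
      ring
  intro t ht
  have hlim : Filter.Tendsto (fun n : ℕ => (M / K) * (1 / 2 : ℝ) ^ n * Real.exp (K * t))
      Filter.atTop (nhds ((M / K) * 0 * Real.exp (K * t))) :=
    ((tendsto_pow_atTop_nhds_zero_of_lt_one (by norm_num) (by norm_num)).const_mul _).mul_const _
  have := ge_of_tendsto' hlim fun n => key n t ht
  rw [mul_zero, zero_mul] at this
  exact sub_eq_zero.1 (abs_nonpos_iff.1 this)

open scoped BoundedContinuousFunction in
theorem exists_front_flowVelocity (hlam : Continuous lam) {L : ℝ} (hL0 : 0 ≤ L)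
    (hL : ∀ x y, |lam x - lam y| ≤ L * |x - y|)
    (hα : Integrable α) (h0 : ∀ r, 0 ≤ α r) (hm : 0 < m) (hm1 : m ≤ 1) (hM1 : 1 ≤ M)
    (hlm : ∀ w, m ≤ lam w) (hlM : ∀ w, lam w ≤ M) :
    ∃ ξ, HasSlopesIn m M ξ ∧ front (flowVelocity lam α ξ) = ξ := by
  have hM : 0 < M := by linarith
  obtain ⟨K, hK, hcontr⟩ := exists_front_contraction hlam hL0 hL hα h0 hm hM
  let curve : (ℝ →ᵇ ℝ) → ℝ → ℝ := fun f t => t + Real.exp (K * t) * f t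
  let X : Set (ℝ →ᵇ ℝ) := {f | (∀ t ≤ 0, f t = 0) ∧ HasSlopesIn m M (curve f)}
  have hev : ∀ t : ℝ, Continuous fun f : ℝ →ᵇ ℝ => f t := fun t =>
    continuous_eval_const t
  have hcurve : ∀ t : ℝ, Continuous fun f : ℝ →ᵇ ℝ => curve f t := fun t =>
    continuous_const.add (continuous_const.mul (hev t))
  have hX : IsClosed X := by
    have hXeq : X = (⋂ t, ⋂ (_ : t ≤ 0), {f : ℝ →ᵇ ℝ | f t = 0}) ∩ ⋂ s, ⋂ t, ⋂ (_ : s ≤ t),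
        ({f | m * (t - s) ≤ curve f t - curve f s} ∩ {f | curve f t - curve f s ≤ M * (t - s)}) := by
      ext f
      simp [X, HasSlopesIn]
    rw [hXeq]
    refine IsClosed.inter ?_ ?_
    · exact isClosed_iInter fun t => isClosed_iInter fun _ => isClosed_eq (hev t) continuous_const
    · refine isClosed_iInter fun s => isClosed_iInter fun t => isClosed_iInter fun _ => ?_
      exact (isClosed_le continuous_const ((hcurve t).sub (hcurve s))).inter
        (isClosed_le ((hcurve t).sub (hcurve s)) continuous_const)
  have hidslope : HasSlopesIn m M (fun t => t) := fun s t hst =>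
    ⟨by nlinarith, by nlinarith⟩
  have hlift : ∀ ξ : ℝ → ℝ, HasSlopesIn m M ξ → (∀ t ≤ 0, ξ t = t) →
      ∃ g : X, curve g.1 = ξ := by
    intro ξ hξ hid
    have hcont : Continuous fun t => Real.exp (-(K * t)) * (ξ t - t) := by
      have := hξ.continuous hm
      fun_prop
    let g : ℝ →ᵇ ℝ := BoundedContinuousFunction.ofNormedAddCommGroup _ hcont (M / K) (by
      intro t
      rw [norm_mul, Real.norm_eq_abs, Real.norm_eq_abs, abs_of_pos (Real.exp_pos _), Real.exp_neg,
        inv_mul_le_iff₀ (Real.exp_pos _), mul_comm]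
      exact hξ.le_mul_exp hidslope hm hid hK t)
    have hg : curve g = ξ := by
      funext t
      change t + Real.exp (K * t) * (Real.exp (-(K * t)) * (ξ t - t)) = ξ t
      rw [← mul_assoc, ← Real.exp_add]
      simp
    refine ⟨⟨g, fun t ht => ?_, ?_⟩, hg⟩
    · change Real.exp (-(K * t)) * (ξ t - t) = 0
      rw [hid t ht, sub_self, mul_zero]
    · rw [hg]; exact hξ
  have hstep : ∀ f : X, ∃ g : X, curve g.1 = front (flowVelocity lam α (curve f.1)) := fun f =>
    hlift _ (front_hasSlopesIn (continuous_flowVelocity hlam hα hm f.2.2) hm1 hM1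
      (fun _ => hlm _) (fun _ => hlM _)) fun t ht => front_of_nonpos ht
  choose Φ hΦ using hstep
  have hdiff : ∀ (f g : ℝ →ᵇ ℝ) (t : ℝ), curve f t - curve g t =
      Real.exp (K * t) * (f t - g t) := fun f g t => by simp only [curve]; ring
  have hΦc : ContractingWith (1 / 2) Φ := by
    refine ⟨by norm_num, LipschitzWith.of_dist_le_mul fun f g => ?_⟩
    rw [Subtype.dist_eq, Subtype.dist_eq]
    refine (BoundedContinuousFunction.dist_le (by positivity)).2 fun t => ?_
    have := hcontr (curve f.1) (curve g.1) f.2.2 g.2.2 (dist f.1 g.1) t dist_nonneg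
      (fun s _ => by
        rw [hdiff, abs_mul, abs_of_pos (Real.exp_pos _), mul_comm]
        refine mul_le_mul_of_nonneg_right ?_ (Real.exp_pos _).le
        rw [← Real.dist_eq]
        exact BoundedContinuousFunction.dist_coe_le_dist s)
    rw [← hΦ, ← hΦ, hdiff, abs_mul, abs_of_pos (Real.exp_pos _), mul_comm] at this
    rw [Real.dist_eq]
    refine (le_of_mul_le_mul_right this (Real.exp_pos _)).trans (le_of_eq ?_)
    simp
    ring
  obtain ⟨f₀, _⟩ := hlift _ hidslope fun _ _ => rfl
  have : Nonempty X := ⟨f₀⟩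
  have : CompleteSpace X := hX.completeSpace_coe
  have hfix := hΦc.fixedPoint_isFixedPt
  refine ⟨curve (hΦc.fixedPoint Φ).1, (hΦc.fixedPoint Φ).2.2, ?_⟩
  rw [← hΦ, hfix]

end FixedPoint

/-- Weak solutions of the linear transport equation `∂_t ρ + ∂_x (a(t) ρ) = 0` with initial datum
`ρ₀` and boundary datum `a(t) ρ(t,0) = u(t)`. -/
def IsLinearWeakSolution (a : ℝ → ℝ) (T : ℝ) (ρ₀ u : ℝ → ℝ) (ρ : ℝ → ℝ → ℝ) : Prop :=
  (∀ t ∈ Icc (0:ℝ) T, IntegrableOn (ρ t) (Ioc 0 1)) ∧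
  (∀ t ∈ Icc (0:ℝ) T, ∀ ε > (0:ℝ), ∃ η > (0:ℝ), ∀ s ∈ Icc (0:ℝ) T,
      |s - t| < η → (∫ x in Ioc (0:ℝ) 1, |ρ s x - ρ t x|) < ε) ∧
  (∀ τ ∈ Icc (0:ℝ) T, ∀ φ : ℝ → ℝ → ℝ,
      ContDiff ℝ 1 (Function.uncurry φ) →
      (∀ x ∈ Icc (0:ℝ) 1, φ τ x = 0) →
      (∀ t ∈ Icc (0:ℝ) τ, φ t 1 = 0) →
      (∫ t in Ioc (0:ℝ) τ, ∫ x in Ioc (0:ℝ) 1,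
          ρ t x * (deriv (fun s => φ s x) t + a t * deriv (φ t) x))
        + (∫ t in Ioc (0:ℝ) τ, u t * φ t 0)
        + (∫ x in Ioc (0:ℝ) 1, ρ₀ x * φ 0 x) = 0)

lemma isWeakSolution_iff {lam : ℝ → ℝ} {T : ℝ} {ρ₀ u : ℝ → ℝ} {ρ : ℝ → ℝ → ℝ} {a : ℝ → ℝ}
    (ha : ∀ t ∈ Icc 0 T, a t = lam (∫ y in Ioc (0:ℝ) 1, ρ t y)) :
    IsWeakSolution lam T ρ₀ u ρ ↔ IsLinearWeakSolution a T ρ₀ u ρ := by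
  have key : ∀ τ ∈ Icc (0:ℝ) T, ∀ φ : ℝ → ℝ → ℝ,
      (∫ t in Ioc (0:ℝ) τ, ∫ x in Ioc (0:ℝ) 1,
        ρ t x * (deriv (fun s => φ s x) t
          + lam (∫ y in Ioc (0:ℝ) 1, ρ t y) * deriv (φ t) x)) =
      ∫ t in Ioc (0:ℝ) τ, ∫ x in Ioc (0:ℝ) 1,
        ρ t x * (deriv (fun s => φ s x) t + a t * deriv (φ t) x) := by
    intro τ hτ φ
    refine setIntegral_congr_fun measurableSet_Ioc fun t ht => ?_
    rw [ha t ⟨ht.1.le, ht.2.trans hτ.2⟩]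
  unfold IsWeakSolution IsLinearWeakSolution
  refine and_congr_right fun _ => and_congr_right fun _ => ?_
  refine forall₂_congr fun τ hτ => forall_congr' fun φ => ?_
  rw [key τ hτ φ]

section Pairing

variable {T : ℝ} {ρ : ℝ → ℝ → ℝ}

lemma continuousOn_integral_mul
    (hint : ∀ t ∈ Icc (0:ℝ) T, IntegrableOn (ρ t) (Ioc 0 1))
    (hcont : ∀ t ∈ Icc (0:ℝ) T, ∀ ε > (0:ℝ), ∃ η > (0:ℝ), ∀ s ∈ Icc (0:ℝ) T,
      |s - t| < η → (∫ x in Ioc (0:ℝ) 1, |ρ s x - ρ t x|) < ε)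
    {g : ℝ → ℝ → ℝ} (hg : Continuous (Function.uncurry g)) {C : ℝ} (hC : ∀ t x, |g t x| ≤ C) :
    ContinuousOn (fun t => ∫ x in Ioc (0:ℝ) 1, ρ t x * g t x) (Icc 0 T) := by
  have hC0 : 0 ≤ C := (abs_nonneg _).trans (hC 0 0)
  have hgm : ∀ t, AEStronglyMeasurable (g t) (volume.restrict (Ioc (0:ℝ) 1)) := fun t =>
    (hg.comp (Continuous.prodMk_right t)).aestronglyMeasurable
  rw [Metric.continuousOn_iff]
  intro t ht ε hε
  have hH : Continuous fun s => ∫ x in Ioc (0:ℝ) 1, ρ t x * g s x := by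
    refine continuous_of_dominated (bound := fun x => |ρ t x| * C) (fun s => ?_) (fun s => ?_)
      ((hint t ht).abs.mul_const C) ?_
    · exact (hint t ht).aestronglyMeasurable.mul (hgm s)
    · refine Filter.Eventually.of_forall fun x => ?_
      rw [norm_mul]
      exact mul_le_mul_of_nonneg_left (hC s x) (norm_nonneg _)
    · exact Filter.Eventually.of_forall fun x =>
        continuous_const.mul (hg.comp (Continuous.prodMk_left x))
  obtain ⟨δ, hδ, hδ'⟩ := Metric.continuous_iff.1 hH t (ε / 2) (by positivity)
  obtain ⟨η, hη, hη'⟩ := hcont t ht (ε / (2 * (C + 1))) (by positivity)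
  refine ⟨min δ η, lt_min hδ hη, fun s hs hst => ?_⟩
  have h1 := hδ' s (hst.trans_le (min_le_left _ _))
  have h2 := hη' s hs (hst.trans_le (min_le_right _ _))
  have hbd : ∀ r : ℝ, ∀ᵐ x ∂(volume.restrict (Ioc (0:ℝ) 1)), ‖g r x‖ ≤ C := fun r =>
    Filter.Eventually.of_forall fun x => hC r x
  have i1 : IntegrableOn (fun x => ρ s x * g s x) (Ioc 0 1) :=
    (hint s hs).mul_bdd (hgm s) (hbd s)
  have i2 : IntegrableOn (fun x => ρ t x * g s x) (Ioc 0 1) :=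
    (hint t ht).mul_bdd (hgm s) (hbd s)
  have h3 : |(∫ x in Ioc (0:ℝ) 1, ρ s x * g s x) - ∫ x in Ioc (0:ℝ) 1, ρ t x * g s x| ≤
      (∫ x in Ioc (0:ℝ) 1, |ρ s x - ρ t x|) * C := by
    rw [← integral_sub i1 i2, ← integral_mul_const]
    refine (abs_integral_le_integral_abs).trans (integral_mono (i1.sub i2).abs
      (((hint s hs).sub (hint t ht)).abs.mul_const C) fun x => ?_)
    simp only
    rw [← sub_mul, abs_mul]
    exact mul_le_mul_of_nonneg_left (hC s x) (abs_nonneg _)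
  have h4 : (∫ x in Ioc (0:ℝ) 1, |ρ s x - ρ t x|) * C ≤ ε / (2 * (C + 1)) * (C + 1) := by
    refine mul_le_mul h2.le (by linarith) hC0 (by positivity)
  have h5 : ε / (2 * (C + 1)) * (C + 1) = ε / 2 := by field_simp
  rw [Real.dist_eq] at h1 ⊢
  calc _ ≤ _ := abs_sub_le _ (∫ x in Ioc (0:ℝ) 1, ρ t x * g s x) _
    _ < ε := by linarith

end Pairing

section Uniqueness

variable {a : ℝ → ℝ} {T : ℝ} {ρ₀ u : ℝ → ℝ} {ρ₁ ρ₂ : ℝ → ℝ → ℝ}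

lemma IsLinearWeakSolution.integral_mul_eq (ha : Continuous a) (ha0 : ∀ t, 0 ≤ a t)
    (h₁ : IsLinearWeakSolution a T ρ₀ u ρ₁) (h₂ : IsLinearWeakSolution a T ρ₀ u ρ₂)
    {τ : ℝ} (hτ : τ ∈ Ioc 0 T) {ψ : ℝ → ℝ} (hψ : ContDiff ℝ 1 ψ) (hψc : HasCompactSupport ψ)
    (hψ1 : ∀ x, 1 ≤ x → ψ x = 0) :
    ∫ x in Ioc (0:ℝ) 1, ρ₁ τ x * ψ x = ∫ x in Ioc (0:ℝ) 1, ρ₂ τ x * ψ x := by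
  have hT : 0 < T := hτ.1.trans_le hτ.2
  set ξ : ℝ → ℝ := fun t => ∫ s in (0:ℝ)..t, a s with hξdef
  have hξ : ∀ t, HasDerivAt ξ (a t) t := fun t => ha.integral_hasStrictDerivAt 0 t |>.hasDerivAt
  have hξ1 : ContDiff ℝ 1 ξ := by
    rw [contDiff_one_iff_deriv]
    refine ⟨fun t => (hξ t).differentiableAt, ?_⟩
    rwa [show deriv ξ = a from funext fun t => (hξ t).deriv]
  have hξm : Monotone ξ := monotone_of_deriv_nonneg (fun t => (hξ t).differentiableAt)
    fun t => by rw [(hξ t).deriv]; exact ha0 t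
  obtain ⟨C, hC⟩ := hψc.exists_bound_of_continuous hψ.continuous
  set g : ℝ → ℝ → ℝ := fun t x => ψ (x + (ξ τ - ξ t)) with hgdef
  have hg1 : ContDiff ℝ 1 (Function.uncurry g) :=
    hψ.comp (contDiff_snd.add (contDiff_const.sub (hξ1.comp contDiff_fst)))
  have F₁ := continuousOn_integral_mul h₁.1 h₁.2.1 hg1.continuous (fun t x => hC _)
  have F₂ := continuousOn_integral_mul h₂.1 h₂.2.1 hg1.continuous (fun t x => hC _)
  set F : ℝ → ℝ := fun t => (∫ x in Ioc (0:ℝ) 1, ρ₁ t x * g t x) -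
    ∫ x in Ioc (0:ℝ) 1, ρ₂ t x * g t x with hF
  have hFc : ContinuousOn F (Icc 0 T) := F₁.sub F₂
  set k : ℝ → ℝ := fun t => F (max 0 (min t T)) with hk
  have hkc : Continuous k := hFc.comp_continuous (by fun_prop)
    fun t => ⟨le_max_left _ _, max_le hT.le (min_le_right _ _)⟩
  have hkF : ∀ t ∈ Icc 0 T, k t = F t := fun t ht => by
    simp only [hk]
    rw [min_eq_left ht.2, max_eq_right ht.1]
  set h : ℝ → ℝ := fun t => ∫ s in τ..t, k s with hh
  have hhd : ∀ t, HasDerivAt h (k t) t := fun t => hkc.integral_hasStrictDerivAt τ t |>.hasDerivAt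
  have hh1 : ContDiff ℝ 1 h := by
    rw [contDiff_one_iff_deriv]
    refine ⟨fun t => (hhd t).differentiableAt, ?_⟩
    rwa [show deriv h = k from funext fun t => (hhd t).deriv]
  set φ : ℝ → ℝ → ℝ := fun t x => h t * g t x with hφ
  have hφ1 : ContDiff ℝ 1 (Function.uncurry φ) := (hh1.comp contDiff_fst).mul hg1
  have hφτ : ∀ x ∈ Icc (0:ℝ) 1, φ τ x = 0 := fun x _ => by simp [hφ, hh]
  have hφb : ∀ t ∈ Icc (0:ℝ) τ, φ t 1 = 0 := fun t ht => by
    have := hξm ht.2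
    simp only [hφ, hgdef]
    rw [hψ1 _ (by linarith), mul_zero]
  have hD : ∀ t x, deriv (fun s => φ s x) t + a t * deriv (φ t) x = k t * g t x := by
    intro t x
    have hψd : ∀ y, HasDerivAt ψ (deriv ψ y) y := fun y =>
      (hψ.differentiable (by norm_num) y).hasDerivAt
    have d1 : HasDerivAt (fun s => g s x) (deriv ψ (x + (ξ τ - ξ t)) * (-a t)) t :=
      HasDerivAt.comp t (hψd _) (((hξ t).const_sub (ξ τ)).const_add x)
    have d2 : HasDerivAt (g t) (deriv ψ (x + (ξ τ - ξ t)) * 1) x :=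
      HasDerivAt.comp x (hψd _) ((hasDerivAt_id x).add_const (ξ τ - ξ t))
    have d3 : HasDerivAt (fun s => φ s x) _ t := (hhd t).mul d1
    have d4 : HasDerivAt (φ t) _ x := d2.const_mul (h t)
    rw [d3.deriv, d4.deriv]
    ring
  have e₁ := h₁.2.2 τ ⟨hτ.1.le, hτ.2⟩ φ hφ1 hφτ hφb
  have e₂ := h₂.2.2 τ ⟨hτ.1.le, hτ.2⟩ φ hφ1 hφτ hφb
  have hred : ∀ ρ : ℝ → ℝ → ℝ, (∫ t in Ioc (0:ℝ) τ, ∫ x in Ioc (0:ℝ) 1,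
      ρ t x * (deriv (fun s => φ s x) t + a t * deriv (φ t) x)) =
      ∫ t in Ioc (0:ℝ) τ, k t * ∫ x in Ioc (0:ℝ) 1, ρ t x * g t x := by
    intro ρ
    refine integral_congr_ae (Filter.Eventually.of_forall fun t => ?_)
    simp only
    rw [← integral_const_mul]
    refine integral_congr_ae (Filter.Eventually.of_forall fun x => ?_)
    simp only
    rw [hD]
    ring
  rw [hred] at e₁ e₂
  have hsub : Icc (0:ℝ) τ ⊆ Icc 0 T := Icc_subset_Icc_right hτ.2
  have j₁ : IntegrableOn (fun t => k t * ∫ x in Ioc (0:ℝ) 1, ρ₁ t x * g t x) (Ioc 0 τ) :=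
    ((hkc.continuousOn.mul (F₁.mono hsub)).integrableOn_Icc).mono_set Ioc_subset_Icc_self
  have j₂ : IntegrableOn (fun t => k t * ∫ x in Ioc (0:ℝ) 1, ρ₂ t x * g t x) (Ioc 0 τ) :=
    ((hkc.continuousOn.mul (F₂.mono hsub)).integrableOn_Icc).mono_set Ioc_subset_Icc_self
  have hzero : ∫ t in (0:ℝ)..τ, k t * k t = 0 := by
    rw [intervalIntegral.integral_of_le hτ.1.le]
    have : ∫ t in Ioc (0:ℝ) τ, k t * k t = ∫ t in Ioc (0:ℝ) τ,
        ((k t * ∫ x in Ioc (0:ℝ) 1, ρ₁ t x * g t x) -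
          k t * ∫ x in Ioc (0:ℝ) 1, ρ₂ t x * g t x) := by
      refine setIntegral_congr_fun measurableSet_Ioc fun t ht => ?_
      rw [← mul_sub]
      congr 1
      exact hkF t ⟨ht.1.le, ht.2.trans hτ.2⟩
    rw [this, integral_sub j₁ j₂]
    linarith
  have hkτ : k τ = 0 := by
    by_contra hne
    have : 0 < ∫ t in (0:ℝ)..τ, k t * k t := intervalIntegral.integral_pos hτ.1
      (hkc.mul hkc).continuousOn (fun t _ => mul_self_nonneg _)
      ⟨τ, right_mem_Icc.2 hτ.1.le, mul_self_pos.2 hne⟩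
    exact absurd hzero (ne_of_gt this)
  have hfin : F τ = 0 := by rw [← hkF τ ⟨hτ.1.le, hτ.2⟩, hkτ]
  have hgτ : ∀ x, g τ x = ψ x := fun x => by simp [hgdef]
  simp only [hF, hgτ] at hfin
  exact sub_eq_zero.1 hfin

theorem IsLinearWeakSolution.ae_eq (hT : 0 < T) (ha : Continuous a) (ha0 : ∀ t, 0 ≤ a t)
    (h₁ : IsLinearWeakSolution a T ρ₀ u ρ₁) (h₂ : IsLinearWeakSolution a T ρ₀ u ρ₂) :
    ∀ t ∈ Icc (0:ℝ) T, ∀ᵐ x ∂(volume.restrict (Ioc (0:ℝ) 1)), ρ₁ t x = ρ₂ t x := by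
  have hpos : ∀ t ∈ Ioc (0:ℝ) T, ∀ᵐ x ∂(volume.restrict (Ioc (0:ℝ) 1)), ρ₁ t x = ρ₂ t x := by
    intro τ hτ
    have hτ' : τ ∈ Icc (0:ℝ) T := ⟨hτ.1.le, hτ.2⟩
    have hI := (h₁.1 τ hτ').sub (h₂.1 τ hτ')
    have := isOpen_Ioo.ae_eq_zero_of_integral_contDiff_smul_eq_zero
      (U := Ioo (0:ℝ) 1) (f := fun x => ρ₁ τ x - ρ₂ τ x) (μ := volume)
      (hI.mono_set Ioo_subset_Ioc_self).locallyIntegrableOn (fun g hg hgc hgs => by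
        have hout : ∀ x, x ∉ Ioo (0:ℝ) 1 → g x = 0 := fun x hx =>
          image_eq_zero_of_notMem_tsupport fun h => hx (hgs h)
        have e := h₁.integral_mul_eq ha ha0 h₂ hτ (hg.of_le (by exact_mod_cast le_top)) hgc
          (fun x hx => hout x fun h => absurd h.2 (not_lt.2 hx))
        obtain ⟨C, hC⟩ := hgc.exists_bound_of_continuous hg.continuous
        have hz : ∀ x, x ∉ Ioc (0:ℝ) 1 → g x • (ρ₁ τ x - ρ₂ τ x) = 0 := fun x hx => by
          rw [hout x fun h => hx (Ioo_subset_Ioc_self h), zero_smul]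
        rw [← setIntegral_eq_integral_of_forall_compl_eq_zero hz]
        have i₁ := (h₁.1 τ hτ').mul_bdd (c := C) hg.continuous.aestronglyMeasurable
          (Filter.Eventually.of_forall hC)
        have i₂ := (h₂.1 τ hτ').mul_bdd (c := C) hg.continuous.aestronglyMeasurable
          (Filter.Eventually.of_forall hC)
        rw [← sub_eq_zero, ← integral_sub i₁ i₂] at e
        refine Eq.trans ?_ e
        refine integral_congr_ae (Filter.Eventually.of_forall fun x => ?_)
        simp only [smul_eq_mul]
        ring)
    rw [← restrict_Ioo_eq_restrict_Ioc, ae_restrict_iff' measurableSet_Ioo]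
    filter_upwards [this] with x hx hx'
    exact sub_eq_zero.1 (hx hx')
  intro t ht
  rcases ht.1.eq_or_lt with rfl | h
  swap
  · exact hpos t ⟨h, ht.2⟩
  have hI := ((h₁.1 0 ht).sub (h₂.1 0 ht)).abs
  have hle : ∫ x in Ioc (0:ℝ) 1, |ρ₁ 0 x - ρ₂ 0 x| ≤ 0 := by
    refine le_of_forall_pos_le_add fun ε hε => ?_
    obtain ⟨η₁, hη₁, k₁⟩ := h₁.2.1 0 ht (ε / 2) (by positivity)
    obtain ⟨η₂, hη₂, k₂⟩ := h₂.2.1 0 ht (ε / 2) (by positivity)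
    obtain ⟨s, hs0, hs⟩ := exists_between (lt_min hT (lt_min hη₁ hη₂))
    rw [lt_min_iff, lt_min_iff] at hs
    have hs' : s ∈ Icc (0:ℝ) T := ⟨hs0.le, hs.1.le⟩
    have habs : |s - 0| = s := by rw [sub_zero, abs_of_pos hs0]
    have l₁ := k₁ s hs' (by rw [habs]; exact hs.2.1)
    have l₂ := k₂ s hs' (by rw [habs]; exact hs.2.2)
    have q₁ : IntegrableOn (fun x => |ρ₁ s x - ρ₁ 0 x|) (Ioc 0 1) :=
      ((h₁.1 s hs').sub (h₁.1 0 ht)).abs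
    have q₂ : IntegrableOn (fun x => |ρ₂ s x - ρ₂ 0 x|) (Ioc 0 1) :=
      ((h₂.1 s hs').sub (h₂.1 0 ht)).abs
    have : ∫ x in Ioc (0:ℝ) 1, |ρ₁ 0 x - ρ₂ 0 x| ≤
        ∫ x in Ioc (0:ℝ) 1, (|ρ₁ s x - ρ₁ 0 x| + |ρ₂ s x - ρ₂ 0 x|) := by
      refine integral_mono_ae hI (q₁.add q₂) ?_
      filter_upwards [hpos s ⟨hs0, hs.1.le⟩] with x hx
      rw [hx, abs_sub_comm (ρ₂ s x) (ρ₁ 0 x)]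
      exact abs_sub_le _ _ _
    rw [integral_add q₁ q₂] at this
    linarith
  have hz := (integral_eq_zero_iff_of_nonneg (fun x => abs_nonneg _) hI).1
    (le_antisymm hle (integral_nonneg fun x => abs_nonneg _))
  filter_upwards [hz] with x hx
  exact sub_eq_zero.1 (abs_eq_zero.1 hx)

end Uniqueness

/-- Translation is continuous in `L¹(ℝ)`. -/
lemma exists_forall_integral_abs_comp_add_sub_lt {q : ℝ → ℝ} (hq : Integrable q) {ε : ℝ}
    (hε : 0 < ε) : ∃ δ > (0:ℝ), ∀ h, |h| < δ → ∫ y, |q (y + h) - q y| < ε := by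
  obtain ⟨g, hgs, hg, hgc, hgi⟩ := hq.exists_hasCompactSupport_integral_sub_le
    (show 0 < ε / 4 by positivity)
  obtain ⟨R, hR⟩ := hgs.isCompact.isBounded.exists_norm_le
  have hzero : ∀ y, R < |y| → g y = 0 := fun y hy => by
    by_contra hne
    exact absurd (hR y (subset_tsupport _ hne)) (by simpa using hy)
  have hcont : Continuous fun h : ℝ => ∫ y in Icc (-(R + 1)) (R + 1), |g (y + h) - g y| :=
    continuous_parametric_integral_of_continuous (by fun_prop) isCompact_Icc
  have h0 : (∫ y in Icc (-(R + 1)) (R + 1), |g (y + 0) - g y|) = 0 := by simp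
  obtain ⟨δ, hδ, hball⟩ := Metric.continuousAt_iff.1 (hcont.continuousAt (x := 0)) (ε / 2) (by positivity)
  refine ⟨min δ 1, by positivity, fun h hh => ?_⟩
  have hsmall : ∫ y, |g (y + h) - g y| < ε / 2 := by
    have hb := hball (x := h) (by
      simpa [Real.dist_eq] using hh.trans_le (min_le_left _ _))
    rw [h0, Real.dist_eq, sub_zero] at hb
    refine lt_of_eq_of_lt ?_ (lt_of_abs_lt hb)
    refine (setIntegral_eq_integral_of_forall_compl_eq_zero fun y hy => ?_).symm
    have hy' : R + 1 < |y| := by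
      by_contra! hc
      exact hy (abs_le.1 hc)
    have h1 := hh.trans_le (min_le_right _ _)
    have h2 : |y| - |h| ≤ |y + h| := by
      have := abs_sub_abs_le_abs_sub y (-h)
      simpa using this
    rw [hzero y (by linarith), hzero (y + h) (by linarith)]
    simp
  have i1 : Integrable fun y => |q (y + h) - g (y + h)| :=
    ((hq.sub hgi).comp_add_right h).abs
  have i2 : Integrable fun y => |g (y + h) - g y| := ((hgi.comp_add_right h).sub hgi).abs
  have i3 : Integrable fun y => |q y - g y| := (hq.sub hgi).abs
  have i12 : Integrable fun y => |q (y + h) - g (y + h)| + |g (y + h) - g y| := i1.add i2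
  have e1 : ∫ y, |q (y + h) - g (y + h)| = ∫ y, |q y - g y| :=
    integral_add_right_eq_self (fun y => |q y - g y|) h
  have hg' : ∫ y, |q y - g y| ≤ ε / 4 := by simpa using hg
  calc ∫ y, |q (y + h) - q y|
      ≤ ∫ y, (|q (y + h) - g (y + h)| + |g (y + h) - g y| + |q y - g y|) := by
        refine integral_mono ((hq.comp_add_right h).sub hq).abs (i12.add i3) fun y => ?_
        have := abs_sub_le (q (y + h)) (g (y + h)) (q y)
        have h2 := abs_sub_le (g (y + h)) (g y) (q y)
        rw [abs_sub_comm (g y)] at h2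
        simp only
        linarith
    _ = (∫ y, |q y - g y|) + (∫ y, |g (y + h) - g y|) + ∫ y, |q y - g y| := by
        rw [integral_add i12 i3, integral_add i1 i2, e1]
    _ < ε := by linarith

/-- The profile transported along the front: at time `t` the density at `x` is the value of the
profile at `front a t - x`. -/
def frontProfile (a α : ℝ → ℝ) (z : ℝ) : ℝ :=
  α (Function.invFun (front a) z) /
    (if Function.invFun (front a) z ≤ 0 then 1 else a (Function.invFun (front a) z))

section FrontProfile

variable {a α : ℝ → ℝ} {m M : ℝ}

lemma frontProfile_nonneg (ha0 : ∀ t, 0 ≤ a t) (h0 : ∀ r, 0 ≤ α r) (z : ℝ) :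
    0 ≤ frontProfile a α z := by
  unfold frontProfile
  refine div_nonneg (h0 _) ?_
  split_ifs
  · exact zero_le_one
  · exact ha0 _

lemma image_front_compl (hm : 0 < m) (hs : HasSlopesIn m M (front a)) :
    front a '' {0}ᶜ = {0}ᶜ := by
  rw [image_compl_eq ⟨(hs.strictMono hm).injective, hs.surjective hm⟩, image_singleton,
    front_of_nonpos le_rfl]

lemma abs_smul_frontProfile (ha0 : ∀ t, 0 < a t) (hm : 0 < m) (hs : HasSlopesIn m M (front a))
    (ψ : ℝ → ℝ) (r : ℝ) :
    |if r ≤ 0 then 1 else a r| • (frontProfile a α (front a r) * ψ (front a r)) =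
      α r * ψ (front a r) := by
  have hb : 0 < (if r ≤ 0 then 1 else a r) := by
    split_ifs
    · exact zero_lt_one
    · exact ha0 r
  rw [frontProfile, hs.invFun_apply hm, abs_of_pos hb, smul_eq_mul]
  field_simp

lemma integrable_frontProfile_mul_iff (ha : Continuous a) (ha0 : ∀ t, 0 < a t) (hm : 0 < m)
    (hs : HasSlopesIn m M (front a)) (ψ : ℝ → ℝ) :
    Integrable (fun z => frontProfile a α z * ψ z) ↔ Integrable fun r => α r * ψ (front a r) := by
  have h := integrableOn_image_iff_integrableOn_abs_deriv_smul (f := front a)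
    (f' := fun r => if r ≤ 0 then 1 else a r) (s := {0}ᶜ) (measurableSet_singleton 0).compl
    (fun r hr => (hasDerivAt_front ha hr).hasDerivWithinAt) (hs.strictMono hm).injective.injOn
    (fun z => frontProfile a α z * ψ z)
  simp only [abs_smul_frontProfile ha0 hm hs, image_front_compl hm hs, IntegrableOn,
    restrict_compl_singleton] at h
  exact h

lemma integral_frontProfile_mul (ha : Continuous a) (ha0 : ∀ t, 0 < a t) (hm : 0 < m)
    (hs : HasSlopesIn m M (front a)) (ψ : ℝ → ℝ) :
    ∫ z, frontProfile a α z * ψ z = ∫ r, α r * ψ (front a r) := by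
  have h := integral_image_eq_integral_abs_deriv_smul (f := front a)
    (f' := fun r => if r ≤ 0 then 1 else a r) (s := {0}ᶜ) (measurableSet_singleton 0).compl
    (fun r hr => (hasDerivAt_front ha hr).hasDerivWithinAt) (hs.strictMono hm).injective.injOn
    (fun z => frontProfile a α z * ψ z)
  simp only [abs_smul_frontProfile ha0 hm hs, image_front_compl hm hs,
    restrict_compl_singleton] at h
  exact h

lemma integrable_frontProfile (ha : Continuous a) (ha0 : ∀ t, 0 < a t) (hm : 0 < m)
    (hs : HasSlopesIn m M (front a)) (hα : Integrable α) : Integrable (frontProfile a α) := by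
  simpa using (integrable_frontProfile_mul_iff (α := α) ha ha0 hm hs fun _ => 1).2 (by simpa)

lemma integral_Ioc_frontProfile_mul (g : ℝ → ℝ) (t : ℝ) :
    ∫ x in Ioc (0:ℝ) 1, frontProfile a α (front a t - x) * g x =
      ∫ z, frontProfile a α z * (Ioc (0:ℝ) 1).indicator g (front a t - z) := by
  rw [← integral_indicator measurableSet_Ioc, ← integral_sub_left_eq_self _ volume (front a t)]
  refine integral_congr_ae (ae_of_all _ fun z => ?_)
  simp only [indicator, sub_sub_cancel]
  split_ifs <;> simp

lemma front_sub_front_mem_Ioc (hm : 0 < m) (hs : HasSlopesIn m M (front a)) (t r : ℝ) :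
    front a t - front a r ∈ Ioc (0:ℝ) 1 ↔ r ∈ Ico (exitLabel (front a) t) t := by
  have h1 : exitLabel (front a) t ≤ r ↔ front a t - 1 ≤ front a r := by
    rw [← hs.apply_exitLabel hm, (hs.strictMono hm).le_iff_le]
  rw [mem_Ioc, mem_Ico, h1, sub_pos, (hs.strictMono hm).lt_iff_lt, sub_le_comm, and_comm]

lemma integral_Ioc_frontProfile (ha : Continuous a) (ha0 : ∀ t, 0 < a t) (hm : 0 < m)
    (hs : HasSlopesIn m M (front a)) (hα : Integrable α) (t : ℝ) :
    ∫ x in Ioc (0:ℝ) 1, frontProfile a α (front a t - x) =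
      (∫ r in (0:ℝ)..t, α r) - ∫ r in (0:ℝ)..exitLabel (front a) t, α r := by
  have h := integral_Ioc_frontProfile_mul (a := a) (α := α) (fun _ => 1) t
  rw [integral_frontProfile_mul ha ha0 hm hs fun z =>
    (Ioc (0:ℝ) 1).indicator (fun _ => 1) (front a t - z)] at h
  simp only [mul_one] at h
  rw [h, intervalIntegral.integral_interval_sub_left hα.intervalIntegrable hα.intervalIntegrable,
    intervalIntegral.integral_of_le (hs.exitLabel_le hm t), ← integral_Ico_eq_integral_Ioc,
    ← integral_indicator measurableSet_Ico]
  refine integral_congr_ae (ae_of_all _ fun r => ?_)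
  simp only [indicator, front_sub_front_mem_Ioc hm hs]
  split_ifs <;> simp

end FrontProfile

section LinearExistence

variable {a α : ℝ → ℝ} {m M : ℝ}

lemma hasDerivAt_curve {φ : ℝ → ℝ → ℝ} (hφ : ContDiff ℝ 1 (Function.uncurry φ))
    {x : ℝ → ℝ} {x' t : ℝ} (hx : HasDerivAt x x' t) :
    HasDerivAt (fun s => φ s (x s)) (fderiv ℝ (Function.uncurry φ) (t, x t) (1, x')) t :=
  HasFDerivAt.comp_hasDerivAt (l := Function.uncurry φ) (f := fun s => (s, x s)) t
    (hφ.differentiable one_ne_zero).differentiableAt.hasFDerivAt ((hasDerivAt_id t).prodMk hx)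

lemma deriv_add_mul_deriv_eq_fderiv {φ : ℝ → ℝ → ℝ} (hφ : ContDiff ℝ 1 (Function.uncurry φ))
    (t x c : ℝ) : deriv (fun s => φ s x) t + c * deriv (φ t) x =
      fderiv ℝ (Function.uncurry φ) (t, x) (1, c) := by
  have h2 : HasDerivAt (φ t) (fderiv ℝ (Function.uncurry φ) (t, x) (0, 1)) x :=
    HasFDerivAt.comp_hasDerivAt (l := Function.uncurry φ) (f := fun y => (t, y)) x
      (hφ.differentiable one_ne_zero).differentiableAt.hasFDerivAt
      ((hasDerivAt_const x t).prodMk (hasDerivAt_id x))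
  have e : ((1:ℝ), c) = (1, 0) + c • ((0:ℝ), (1:ℝ)) := by simp
  rw [(hasDerivAt_curve hφ (hasDerivAt_const t x)).deriv, h2.deriv, e, map_add, map_smul,
    smul_eq_mul]

lemma hasDerivAt_uncurry_comp {φ : ℝ → ℝ → ℝ} (hφ : ContDiff ℝ 1 (Function.uncurry φ))
    {x : ℝ → ℝ} {x' t : ℝ} (hx : HasDerivAt x x' t) :
    HasDerivAt (fun s => φ s (x s)) (deriv (fun s => φ s (x t)) t + x' * deriv (φ t) (x t)) t := by
  rw [deriv_add_mul_deriv_eq_fderiv hφ]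
  exact hasDerivAt_curve hφ hx

lemma continuous_transportDeriv (ha : Continuous a) {φ : ℝ → ℝ → ℝ}
    (hφ : ContDiff ℝ 1 (Function.uncurry φ)) :
    Continuous fun p : ℝ × ℝ =>
      deriv (fun s => φ s p.2) p.1 + a p.1 * deriv (φ p.1) p.2 := by
  have hc := hφ.continuous_fderiv one_ne_zero
  simp_rw [deriv_add_mul_deriv_eq_fderiv hφ]
  fun_prop

/-- Integral of the transported derivative of a test function along the characteristic with
label `r`. -/
lemma integral_indicator_characteristic (ha : Continuous a) (hm : 0 < m)
    (hs : HasSlopesIn m M (front a)) {τ : ℝ} (hτ : 0 ≤ τ) {φ : ℝ → ℝ → ℝ}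
    (hφ : ContDiff ℝ 1 (Function.uncurry φ)) (hφτ : ∀ x ∈ Icc (0:ℝ) 1, φ τ x = 0)
    (hφ1 : ∀ t ∈ Icc (0:ℝ) τ, φ t 1 = 0) (r : ℝ) :
    ∫ t in Ioc (0:ℝ) τ, (Ioc (0:ℝ) 1).indicator
        (fun x => deriv (fun s => φ s x) t + a t * deriv (φ t) x) (front a t - front a r) =
      (Ioo (-1) τ).indicator (fun r => -φ (max 0 r) (front a (max 0 r) - front a r)) r := by
  set e := Function.invFun (front a) (front a r + 1) with he
  have hse : front a e = front a r + 1 := hs.apply_invFun hm _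
  have hmono := hs.strictMono hm
  have hre : r < e := hmono.lt_iff_lt.1 (by linarith)
  have hset : ∫ t in Ioc (0:ℝ) τ, (Ioc (0:ℝ) 1).indicator
        (fun x => deriv (fun s => φ s x) t + a t * deriv (φ t) x) (front a t - front a r) =
      ∫ t in Ioc (max 0 r) (min τ e),
        (deriv (fun s => φ s (front a t - front a r)) t +
          a t * deriv (φ t) (front a t - front a r)) := by
    rw [← integral_indicator measurableSet_Ioc, ← integral_indicator measurableSet_Ioc]
    refine integral_congr_ae (ae_of_all _ fun t => ?_)
    have h1 : front a t - front a r ∈ Ioc (0:ℝ) 1 ↔ r < t ∧ t ≤ e := by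
      rw [mem_Ioc, sub_pos, hmono.lt_iff_lt, sub_le_iff_le_add', ← hse, hmono.le_iff_le]
    have h2 : t ∈ Ioc (max 0 r) (min τ e) ↔ t ∈ Ioc 0 τ ∧ (r < t ∧ t ≤ e) := by
      simp only [mem_Ioc, max_lt_iff, le_min_iff]
      tauto
    simp only [indicator, h1, h2]
    split_ifs <;> tauto
  rw [hset]
  by_cases hr : r ∈ Ioo (-1) τ
  · rw [indicator_of_mem hr]
    have he0 : 0 < e := by
      refine hmono.lt_iff_lt.1 ?_
      rw [hse, front_of_nonpos le_rfl]
      rcases le_or_gt r 0 with h | h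
      · rw [front_of_nonpos h]
        linarith [hr.1]
      · have := hmono h
        rw [front_of_nonpos le_rfl] at this
        linarith
    have hle : max 0 r ≤ min τ e := max_le (le_min hτ he0.le) (le_min hr.2.le hre.le)
    set x : ℝ → ℝ := fun t => (∫ s in (0:ℝ)..t, a s) - front a r with hx
    have hx' : ∀ t, HasDerivAt x (a t) t := fun t =>
      (intervalIntegral.integral_hasDerivAt_right (ha.intervalIntegrable _ _)
        (ha.stronglyMeasurableAtFilter _ _) ha.continuousAt).sub_const _
    have hxc : Continuous x := continuous_iff_continuousAt.2 fun t => (hx' t).continuousAt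
    have hxf : ∀ t, 0 ≤ t → x t = front a t - front a r := fun t ht => by
      rw [hx, front_of_nonneg ht]
    have hD := continuous_transportDeriv ha hφ
    have hftc := intervalIntegral.integral_eq_sub_of_hasDerivAt (a := max 0 r) (b := min τ e)
      (fun t _ => hasDerivAt_uncurry_comp hφ (hx' t))
      ((hD.comp (continuous_id.prodMk hxc)).intervalIntegrable _ _)
    have hend : φ (min τ e) (x (min τ e)) = 0 := by
      rw [hxf _ (le_min hτ he0.le)]
      rcases le_total τ e with h | h
      · rw [min_eq_left h]
        refine hφτ _ ⟨?_, ?_⟩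
        · linarith [hmono.monotone hr.2.le]
        · linarith [hmono.monotone h]
      · rw [min_eq_right h, hse, add_sub_cancel_left]
        exact hφ1 e ⟨he0.le, h⟩
    rw [hend, zero_sub, hxf _ (le_max_left _ _), intervalIntegral.integral_of_le hle] at hftc
    rw [← hftc]
    refine setIntegral_congr_fun measurableSet_Ioc fun t ht => ?_
    simp only [hxf t ((le_max_left _ _).trans ht.1.le)]
  · rw [indicator_of_notMem hr, Ioc_eq_empty, setIntegral_empty]
    intro hlt
    rw [max_lt_iff, lt_min_iff, lt_min_iff] at hlt
    refine hr ⟨?_, hlt.2.1⟩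
    have h0e := hmono hlt.1.2
    rw [hse, front_of_nonpos le_rfl] at h0e
    rcases le_or_gt r 0 with h | h
    · rw [front_of_nonpos h] at h0e
      linarith
    · linarith

/-- The weak formulation holds for the profile transported along the front. -/
lemma frontProfile_weak_identity (ha : Continuous a) (ha0 : ∀ t, 0 < a t) (hm : 0 < m)
    (hs : HasSlopesIn m M (front a)) (hα : Integrable α) {τ : ℝ} (hτ : 0 ≤ τ) {φ : ℝ → ℝ → ℝ}
    (hφ : ContDiff ℝ 1 (Function.uncurry φ)) (hφτ : ∀ x ∈ Icc (0:ℝ) 1, φ τ x = 0)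
    (hφ1 : ∀ t ∈ Icc (0:ℝ) τ, φ t 1 = 0) :
    (∫ t in Ioc (0:ℝ) τ, ∫ x in Ioc (0:ℝ) 1, frontProfile a α (front a t - x) *
          (deriv (fun s => φ s x) t + a t * deriv (φ t) x))
        + (∫ t in Ioc (0:ℝ) τ, α t * φ t 0)
        + (∫ x in Ioc (0:ℝ) 1, α (-x) * φ 0 x) = 0 := by
  set D : ℝ × ℝ → ℝ := fun p => deriv (fun s => φ s p.2) p.1 + a p.1 * deriv (φ p.1) p.2 with hDdef
  have hD : Continuous D := continuous_transportDeriv ha hφ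
  have hfc := hs.continuous hm
  set S : Set (ℝ × ℝ) := {p | p.1 ∈ Ioc 0 τ ∧ front a p.1 - p.2 ∈ Ioc (0:ℝ) 1} with hS
  have hSm : MeasurableSet S :=
    (measurable_fst measurableSet_Ioc).inter
      ((by fun_prop : Measurable fun p : ℝ × ℝ => front a p.1 - p.2) measurableSet_Ioc)
  set k : ℝ × ℝ → ℝ := S.indicator fun p => D (p.1, front a p.1 - p.2) with hk
  have hkm : Measurable k :=
    (by fun_prop : Continuous fun p : ℝ × ℝ => D (p.1, front a p.1 - p.2)).measurable.indicator hSm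
  obtain ⟨C, hC⟩ := (isCompact_Icc.prod isCompact_Icc :
    IsCompact (Icc (0:ℝ) τ ×ˢ Icc (0:ℝ) 1)).exists_bound_of_continuousOn hD.continuousOn
  have hkb : ∀ p, ‖k p‖ ≤ max C 0 := fun p => by
    rw [hk]
    by_cases hp : p ∈ S
    · rw [indicator_of_mem hp]
      exact (hC (p.1, front a p.1 - p.2) ⟨Ioc_subset_Icc_self hp.1, Ioc_subset_Icc_self hp.2⟩).trans
        (le_max_left _ _)
    · simp [indicator_of_notMem hp]
  have hkt : ∀ t ∈ Ioc 0 τ, ∀ z,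
      (Ioc (0:ℝ) 1).indicator (fun x => D (t, x)) (front a t - z) = k (t, z) := fun t ht z => by
    by_cases hz : front a t - z ∈ Ioc (0:ℝ) 1
    · rw [indicator_of_mem hz, hk, indicator_of_mem (show (t, z) ∈ S from ⟨ht, hz⟩)]
    · rw [indicator_of_notMem hz, hk, indicator_of_notMem fun h : (t, z) ∈ S => hz h.2]
  have hq := integrable_frontProfile ha ha0 hm hs hα
  have hint : Integrable (Function.uncurry fun t z => frontProfile a α z * k (t, z))
      ((volume.restrict (Ioc 0 τ)).prod volume) :=
    (hq.comp_snd _).mul_bdd hkm.aestronglyMeasurable (ae_of_all _ hkb)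
  have h1 : (∫ t in Ioc (0:ℝ) τ, ∫ x in Ioc (0:ℝ) 1, frontProfile a α (front a t - x) * D (t, x)) =
      ∫ r, α r * (Ioo (-1) τ).indicator
        (fun r => -φ (max 0 r) (front a (max 0 r) - front a r)) r := by
    calc (∫ t in Ioc (0:ℝ) τ, ∫ x in Ioc (0:ℝ) 1, frontProfile a α (front a t - x) * D (t, x))
        = ∫ t in Ioc (0:ℝ) τ, ∫ z, frontProfile a α z * k (t, z) := by
          refine setIntegral_congr_fun measurableSet_Ioc fun t ht => ?_
          simp only [integral_Ioc_frontProfile_mul (fun x => D (t, x)) t, hkt t ht]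
      _ = ∫ z, frontProfile a α z * ∫ t in Ioc (0:ℝ) τ, k (t, z) := by
          rw [integral_integral_swap hint]
          simp_rw [integral_const_mul]
      _ = _ := by
          rw [integral_frontProfile_mul ha ha0 hm hs]
          congr with r
          rw [← integral_indicator_characteristic ha hm hs hτ hφ hφτ hφ1]
          congr 1
          exact setIntegral_congr_fun measurableSet_Ioc fun t ht => (hkt t ht _).symm
  have hφc : Continuous (Function.uncurry φ) := hφ.continuous
  set G : ℝ → ℝ := fun r => φ (max 0 r) (front a (max 0 r) - front a r) with hG
  have hGc : Continuous G :=
    hφc.comp (by fun_prop : Continuous fun r => (max 0 r, front a (max 0 r) - front a r))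
  have hii : ∀ s t, IntervalIntegrable (fun r => α r * G r) volume s t := fun s t =>
    hα.intervalIntegrable.mul_continuousOn hGc.continuousOn
  have h2 : (∫ r, α r * (Ioo (-1) τ).indicator (fun r => -G r) r) =
      -((∫ r in (-1:ℝ)..0, α r * G r) + ∫ r in (0:ℝ)..τ, α r * G r) := by
    rw [intervalIntegral.integral_add_adjacent_intervals (hii _ _) (hii _ _),
      intervalIntegral.integral_of_le (by linarith), integral_Ioc_eq_integral_Ioo,
      ← integral_indicator measurableSet_Ioo, ← integral_neg]
    refine integral_congr_ae (ae_of_all _ fun r => ?_)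
    simp only [indicator]
    split_ifs <;> simp
  have h3 : (∫ r in (0:ℝ)..τ, α r * G r) = ∫ t in Ioc (0:ℝ) τ, α t * φ t 0 := by
    rw [intervalIntegral.integral_of_le hτ]
    refine setIntegral_congr_fun measurableSet_Ioc fun t ht => ?_
    simp only [hG, max_eq_right ht.1.le, sub_self]
  have h4 : (∫ r in (-1:ℝ)..0, α r * G r) = ∫ x in Ioc (0:ℝ) 1, α (-x) * φ 0 x := by
    have := intervalIntegral.integral_comp_neg (a := 0) (b := 1) fun r => α r * G r
    rw [neg_zero] at this
    rw [← this, intervalIntegral.integral_of_le zero_le_one]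
    refine setIntegral_congr_fun measurableSet_Ioc fun x hx => ?_
    have hx0 : -x ≤ 0 := by linarith [hx.1]
    simp only [hG, max_eq_left hx0, front_of_nonpos hx0, front_of_nonpos le_rfl, zero_sub, neg_neg]
  rw [h1, h2, h3, h4]
  ring

theorem isLinearWeakSolution_frontProfile (ha : Continuous a) (ha0 : ∀ t, 0 < a t) (hm : 0 < m)
    (hs : HasSlopesIn m M (front a)) (hα : Integrable α) (T : ℝ) :
    IsLinearWeakSolution a T (fun x => α (-x)) α (fun t x => frontProfile a α (front a t - x)) := by
  have hq := integrable_frontProfile ha ha0 hm hs hα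
  refine ⟨fun t _ => (hq.comp_sub_left _).integrableOn, fun t _ ε hε => ?_,
    fun τ hτ φ hφ hφτ hφ1 => frontProfile_weak_identity ha ha0 hm hs hα hτ.1 hφ hφτ hφ1⟩
  obtain ⟨δ, hδ, hδε⟩ := exists_forall_integral_abs_comp_add_sub_lt hq hε
  obtain ⟨η, hη, hηδ⟩ := Metric.continuousAt_iff.1 (hs.continuous hm).continuousAt δ hδ
  refine ⟨η, hη, fun s _ hst => ?_⟩
  have hi : Integrable fun y =>
      |frontProfile a α (y + (front a s - front a t)) - frontProfile a α y| :=
    ((hq.comp_add_right _).sub hq).abs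
  calc (∫ x in Ioc (0:ℝ) 1,
        |frontProfile a α (front a s - x) - frontProfile a α (front a t - x)|)
      ≤ ∫ x, |frontProfile a α (front a s - x) - frontProfile a α (front a t - x)| :=
        setIntegral_le_integral ((hq.comp_sub_left _).sub (hq.comp_sub_left _)).abs
          (ae_of_all _ fun _ => abs_nonneg _)
    _ = ∫ y, |frontProfile a α (y + (front a s - front a t)) - frontProfile a α y| := by
        rw [← integral_sub_left_eq_self _ volume (front a t)]
        congr with y
        rw [sub_sub_cancel, show front a s - (front a t - y) = y + (front a s - front a t) by ring]
    _ < ε := hδε _ (hηδ hst)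

end LinearExistence

lemma IsWeakSolution.congr_data {lam : ℝ → ℝ} {T : ℝ} {ρ₀ ρ₀' u u' : ℝ → ℝ} {ρ : ℝ → ℝ → ℝ}
    (hρ₀ : ∀ᵐ x ∂(volume.restrict (Ioc (0:ℝ) 1)), ρ₀ x = ρ₀' x)
    (hu : ∀ᵐ t ∂(volume.restrict (Ioc (0:ℝ) T)), u t = u' t)
    (h : IsWeakSolution lam T ρ₀ u ρ) : IsWeakSolution lam T ρ₀' u' ρ := by
  refine ⟨h.1, h.2.1, fun τ hτ φ hφ hφτ hφ1 => ?_⟩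
  have e1 : (∫ t in Ioc (0:ℝ) τ, u t * φ t 0) = ∫ t in Ioc (0:ℝ) τ, u' t * φ t 0 := by
    refine integral_congr_ae ?_
    filter_upwards [ae_restrict_of_ae_restrict_of_subset (Ioc_subset_Ioc_right hτ.2) hu] with t ht
    rw [ht]
  have e2 : (∫ x in Ioc (0:ℝ) 1, ρ₀ x * φ 0 x) = ∫ x in Ioc (0:ℝ) 1, ρ₀' x * φ 0 x := by
    refine integral_congr_ae ?_
    filter_upwards [hρ₀] with x hx
    rw [hx]
  rw [← e1, ← e2]
  exact h.2.2 τ hτ φ hφ hφτ hφ1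

/-- Nonnegative initial and boundary data can be encoded in a single nonnegative integrable
function on the line, the initial datum being reflected to negative arguments. -/
lemma exists_combined_data {T : ℝ} {ρ₀ u : ℝ → ℝ}
    (hρ₀ : IntegrableOn ρ₀ (Ioc 0 1)) (hu : IntegrableOn u (Ioc 0 T))
    (hρ₀nn : ∀ᵐ x ∂(volume.restrict (Ioc (0:ℝ) 1)), 0 ≤ ρ₀ x)
    (hunn : ∀ᵐ t ∂(volume.restrict (Ioc (0:ℝ) T)), 0 ≤ u t) :
    ∃ α : ℝ → ℝ, Integrable α ∧ (∀ r, 0 ≤ α r) ∧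
      (∀ᵐ x ∂(volume.restrict (Ioc (0:ℝ) 1)), ρ₀ x = α (-x)) ∧
      ∀ᵐ t ∂(volume.restrict (Ioc (0:ℝ) T)), u t = α t := by
  have h1 : Integrable ((Ioc 0 T).indicator fun r => max (u r) 0) :=
    (integrable_indicator_iff measurableSet_Ioc).2 hu.pos_part
  have h2 : Integrable ((Ioc (0:ℝ) 1).indicator fun x => max (ρ₀ x) 0) :=
    (integrable_indicator_iff measurableSet_Ioc).2 hρ₀.pos_part
  refine ⟨fun r => (Ioc 0 T).indicator (fun r => max (u r) 0) r +
    (Ioc (0:ℝ) 1).indicator (fun x => max (ρ₀ x) 0) (-r), h1.add h2.comp_neg, fun r => ?_, ?_, ?_⟩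
  · exact add_nonneg (indicator_nonneg (fun _ _ => le_max_right _ _) _)
      (indicator_nonneg (fun _ _ => le_max_right _ _) _)
  · filter_upwards [hρ₀nn, ae_restrict_mem measurableSet_Ioc] with x hx hmem
    have hn : -x ∉ Ioc 0 T := fun h => by linarith [h.1, hmem.1]
    rw [neg_neg, indicator_of_notMem hn, indicator_of_mem hmem, max_eq_left hx, zero_add]
  · filter_upwards [hunn, ae_restrict_mem measurableSet_Ioc] with t ht hmem
    have hn : -t ∉ Ioc (0:ℝ) 1 := fun h => by linarith [h.1, hmem.1]
    rw [indicator_of_notMem hn, indicator_of_mem hmem, max_eq_left ht, add_zero]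

lemma exists_bounds_Icc {f : ℝ → ℝ} {c d : ℝ} (hcd : c ≤ d) (hf : ContinuousOn f (Icc c d))
    (hpos : ∀ x ∈ Icc c d, 0 < f x) :
    ∃ m M : ℝ, 0 < m ∧ m ≤ 1 ∧ 1 ≤ M ∧ ∀ x ∈ Icc c d, m ≤ f x ∧ f x ≤ M := by
  obtain ⟨x, hx, hmin⟩ := isCompact_Icc.exists_isMinOn (nonempty_Icc.2 hcd) hf
  obtain ⟨y, hy, hmax⟩ := isCompact_Icc.exists_isMaxOn (nonempty_Icc.2 hcd) hf
  exact ⟨min (f x) 1, max (f y) 1, lt_min (hpos x hx) one_pos, min_le_right _ _, le_max_right _ _,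
    fun z hz => ⟨(min_le_left _ _).trans (hmin hz), (hmax hz).trans (le_max_left _ _)⟩⟩

/-- A positive `C¹` function agrees on a compact interval with a globally Lipschitz function which
is bounded above and bounded away from zero. -/
lemma exists_lipschitz_truncation {lam : ℝ → ℝ} (hlam : ContDiff ℝ 1 lam)
    (hpos : ∀ w, 0 < lam w) {A : ℝ} (hA : 0 ≤ A) :
    ∃ (g : ℝ → ℝ) (L m M : ℝ), Continuous g ∧ 0 ≤ L ∧ (∀ x y, |g x - g y| ≤ L * |x - y|) ∧
      0 < m ∧ m ≤ 1 ∧ 1 ≤ M ∧ (∀ w, m ≤ g w) ∧ (∀ w, g w ≤ M) ∧ ∀ w ∈ Icc 0 A, g w = lam w := by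
  obtain ⟨m, M, hm, hm1, hM1, hb⟩ :=
    exists_bounds_Icc hA hlam.continuous.continuousOn fun x _ => hpos x
  obtain ⟨C, hC⟩ := isCompact_Icc.exists_bound_of_continuousOn
    (hlam.continuous_deriv le_rfl).continuousOn (s := Icc 0 A)
  have hC0 : 0 ≤ C := (norm_nonneg _).trans (hC 0 ⟨le_rfl, hA⟩)
  refine ⟨fun w => lam (projIcc 0 A hA w), C, m, M,
    hlam.continuous.comp (continuous_subtype_val.comp continuous_projIcc), hC0, fun x y => ?_,
    hm, hm1, hM1, fun w => (hb _ (projIcc 0 A hA w).2).1, fun w => (hb _ (projIcc 0 A hA w).2).2,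
    fun w hw => by simp only [projIcc_of_mem hA hw]⟩
  have h1 := (convex_Icc 0 A).norm_image_sub_le_of_norm_deriv_le
    (fun x _ => (hlam.differentiable one_ne_zero).differentiableAt) hC
    (projIcc 0 A hA y).2 (projIcc 0 A hA x).2
  have h2 := (LipschitzWith.projIcc hA).dist_le_mul x y
  rw [NNReal.coe_one, one_mul, Subtype.dist_eq, Real.dist_eq, Real.dist_eq] at h2
  exact h1.trans (mul_le_mul_of_nonneg_left h2 hC0)

lemma front_congr {a b : ℝ → ℝ} {T : ℝ} (h : ∀ s ∈ Icc 0 T, a s = b s) {t : ℝ} (ht : t ≤ T) :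
    front a t = front b t := by
  rcases le_total t 0 with h0 | h0
  · rw [front_of_nonpos h0, front_of_nonpos h0]
  · rw [front_of_nonneg h0, front_of_nonneg h0]
    refine intervalIntegral.integral_congr fun s hs => ?_
    rw [uIcc_of_le h0] at hs
    exact h s ⟨hs.1, hs.2.trans ht⟩

lemma exitLabel_congr {m M m' M' : ℝ} {ξ₁ ξ₂ : ℝ → ℝ} (h₁ : HasSlopesIn m M ξ₁) (hm : 0 < m)
    (h₂ : HasSlopesIn m' M' ξ₂) (hm' : 0 < m') {T : ℝ} (h : ∀ t ≤ T, ξ₁ t = ξ₂ t) {t : ℝ}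
    (ht : t ≤ T) : exitLabel ξ₁ t = exitLabel ξ₂ t := by
  refine (h₂.strictMono hm').injective ?_
  rw [h₂.apply_exitLabel hm', ← h _ ((h₁.exitLabel_le hm t).trans ht), h₁.apply_exitLabel hm,
    h t ht]

section Mass

variable {α : ℝ → ℝ} {m M T : ℝ}

lemma primitive_sub_exitLabel_mem_Icc (hα : Integrable α) (h0 : ∀ r, 0 ≤ α r) {ξ : ℝ → ℝ}
    (hm : 0 < m) (hs : HasSlopesIn m M ξ) (t : ℝ) :
    (∫ r in (0:ℝ)..t, α r) - ∫ r in (0:ℝ)..exitLabel ξ t, α r ∈ Icc 0 (∫ r, α r) :=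
  ⟨sub_nonneg.2 (monotone_primitive hα h0 (hs.exitLabel_le hm t)), primitive_sub_le hα h0 _ _⟩

lemma IsLinearWeakSolution.integral_eq {a : ℝ → ℝ} {ρ : ℝ → ℝ → ℝ} (hT : 0 < T)
    (ha : Continuous a) (ha0 : ∀ t, 0 < a t) (hm : 0 < m) (hs : HasSlopesIn m M (front a))
    (hα : Integrable α) (h : IsLinearWeakSolution a T (fun x => α (-x)) α ρ) :
    ∀ t ∈ Icc 0 T, ∫ x in Ioc (0:ℝ) 1, ρ t x =
      (∫ r in (0:ℝ)..t, α r) - ∫ r in (0:ℝ)..exitLabel (front a) t, α r := fun t ht => by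
  rw [← integral_Ioc_frontProfile ha ha0 hm hs hα]
  exact integral_congr_ae (h.ae_eq hT ha (fun t => (ha0 t).le)
    (isLinearWeakSolution_frontProfile ha ha0 hm hs hα T) t ht)

/-- Any weak solution solves the linear transport equation whose velocity comes from the front
fixed point. -/
lemma IsWeakSolution.isLinearWeakSolution_of_front_eq {lam g : ℝ → ℝ} (hT : 0 < T)
    (hlam : Continuous lam) (hpos : ∀ w, 0 < lam w) (hg : Continuous g) {L : ℝ} (hL0 : 0 ≤ L)
    (hL : ∀ x y, |g x - g y| ≤ L * |x - y|) (hm : 0 < m) (hm1 : m ≤ 1) (hM1 : 1 ≤ M)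
    (hgm : ∀ w, m ≤ g w) (hgM : ∀ w, g w ≤ M) (hα : Integrable α) (h0 : ∀ r, 0 ≤ α r)
    (hglam : ∀ w ∈ Icc 0 (∫ r, α r), g w = lam w) {ξ : ℝ → ℝ} (hξ : HasSlopesIn m M ξ)
    (hfix : front (flowVelocity g α ξ) = ξ) {ρ : ℝ → ℝ → ℝ}
    (hρ : IsWeakSolution lam T (fun x => α (-x)) α ρ) :
    IsLinearWeakSolution (flowVelocity g α ξ) T (fun x => α (-x)) α ρ := by
  have hW : ContinuousOn (fun t => lam (∫ x in Ioc (0:ℝ) 1, ρ t x)) (Icc 0 T) := by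
    have := continuousOn_integral_mul (g := fun _ _ => 1) (C := 1) hρ.1 hρ.2.1
      (continuous_const (y := (1:ℝ))) (fun _ _ => by simp)
    simp only [mul_one] at this
    exact hlam.comp_continuousOn this
  set a : ℝ → ℝ := IccExtend hT.le ((Icc 0 T).domRestrict fun t => lam (∫ x in Ioc (0:ℝ) 1, ρ t x))
    with ha
  have hac : Continuous a := hW.domRestrict.Icc_extend'
  have haW : ∀ t ∈ Icc 0 T, a t = lam (∫ x in Ioc (0:ℝ) 1, ρ t x) := fun t ht => by
    rw [ha, IccExtend_of_mem _ _ ht, domRestrict_apply]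
  have haproj : ∀ t, a t = a (projIcc 0 T hT.le t) := fun t => by
    rw [haW _ (projIcc 0 T hT.le t).2]
    rfl
  have ha0 : ∀ t, 0 < a t := fun t => by
    rw [haproj, haW _ (projIcc 0 T hT.le t).2]
    exact hpos _
  have hlin : IsLinearWeakSolution a T (fun x => α (-x)) α ρ := (isWeakSolution_iff haW).1 hρ
  obtain ⟨m', M', hm', hm1', hM1', hb⟩ :=
    exists_bounds_Icc hT.le hac.continuousOn fun t _ => ha0 t
  have hs' : HasSlopesIn m' M' (front a) := front_hasSlopesIn hac hm1' hM1'
    (fun t => by rw [haproj]; exact (hb _ (projIcc 0 T hT.le t).2).1)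
    (fun t => by rw [haproj]; exact (hb _ (projIcc 0 T hT.le t).2).2)
  have haflow : ∀ t ∈ Icc 0 T, a t = flowVelocity g α (front a) t := fun t ht => by
    rw [haW t ht, hlin.integral_eq hT hac ha0 hm' hs' hα t ht, flowVelocity,
      hglam _ (primitive_sub_exitLabel_mem_Icc hα h0 hm' hs' t)]
  have hs : HasSlopesIn m M (front a) := front_hasSlopesIn hac hm1 hM1
    (fun t => by rw [haproj, haflow _ (projIcc 0 T hT.le t).2]; exact hgm _)
    (fun t => by rw [haproj, haflow _ (projIcc 0 T hT.le t).2]; exact hgM _)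
  have heq : ∀ t ≤ T, front a t = ξ t :=
    front_flowVelocity_unique hg hL0 hL hα h0 hm hs hξ
      (fun t ht => (front_congr haflow ht).symm) (fun t _ => congrFun hfix t)
      (fun t ht => by rw [front_of_nonpos ht, ← hfix, front_of_nonpos ht])
  refine (isWeakSolution_iff fun t ht => ?_).1 hρ
  rw [← haW t ht, haflow t ht, flowVelocity, flowVelocity,
    exitLabel_congr hs hm hξ hm heq ht.2]

end Mass

/-- Theorem 2.2: for nonnegative `ρ₀ ∈ L¹(0,1)` and `u ∈ L¹(0,T)`, the Cauchy
problem admits a unique weak solution, which is nonnegative a.e. on `[0,T]×[0,1]`. -/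
theorem exists_unique_weak_solution
    (lam : ℝ → ℝ) (hlam : ContDiff ℝ 1 lam) (hlam_pos : ∀ w, 0 < lam w)
    (T : ℝ) (hT : 0 < T) (ρ₀ u : ℝ → ℝ)
    (hρ₀ : MeasureTheory.IntegrableOn ρ₀ (Set.Ioc 0 1))
    (hu : MeasureTheory.IntegrableOn u (Set.Ioc 0 T))
    (hρ₀nn : ∀ᵐ x ∂(volume.restrict (Set.Ioc (0:ℝ) 1)), 0 ≤ ρ₀ x)
    (hunn : ∀ᵐ t ∂(volume.restrict (Set.Ioc (0:ℝ) T)), 0 ≤ u t) :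
    ∃ ρ : ℝ → ℝ → ℝ, IsWeakSolution lam T ρ₀ u ρ ∧
      (∀ᵐ p ∂((volume.restrict (Set.Ioc (0:ℝ) T)).prod
          (volume.restrict (Set.Ioc (0:ℝ) 1))), 0 ≤ ρ p.1 p.2) ∧
      (∀ ρ' : ℝ → ℝ → ℝ, IsWeakSolution lam T ρ₀ u ρ' →
        ∀ t ∈ Set.Icc (0:ℝ) T,
          ∀ᵐ x ∂(volume.restrict (Set.Ioc (0:ℝ) 1)), ρ' t x = ρ t x) := by
  obtain ⟨α, hα, h0, hαρ₀, hαu⟩ := exists_combined_data hρ₀ hu hρ₀nn hunn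
  obtain ⟨g, L, m, M, hg, hL0, hL, hm, hm1, hM1, hgm, hgM, hglam⟩ :=
    exists_lipschitz_truncation hlam hlam_pos (integral_nonneg h0)
  obtain ⟨ξ, hξ, hfix⟩ := exists_front_flowVelocity hg hL0 hL hα h0 hm hm1 hM1 hgm hgM
  set a := flowVelocity g α ξ with ha
  have hac : Continuous a := continuous_flowVelocity hg hα hm hξ
  have ha0 : ∀ t, 0 < a t := fun t => hm.trans_le (hgm _)
  have hs : HasSlopesIn m M (front a) := hfix.symm ▸ hξ
  have hlin := isLinearWeakSolution_frontProfile hac ha0 hm hs hα T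
  refine ⟨fun t x => frontProfile a α (front a t - x), ?_,
    ae_of_all _ fun p => frontProfile_nonneg (fun t => (ha0 t).le) h0 _, fun ρ' hρ' t ht => ?_⟩
  · refine IsWeakSolution.congr_data (hαρ₀.mono fun _ h => h.symm) (hαu.mono fun _ h => h.symm)
      ((isWeakSolution_iff fun t ht => ?_).2 hlin)
    rw [integral_Ioc_frontProfile hac ha0 hm hs hα,
      ← hglam _ (primitive_sub_exitLabel_mem_Icc hα h0 hm hs t), hfix, ha, flowVelocity]
  · have hρ'' := (hρ'.congr_data hαρ₀ hαu).isLinearWeakSolution_of_front_eq hT hlam.continuous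
      hlam_pos hg hL0 hL hm hm1 hM1 hgm hgM hα h0 hglam hξ hfix
    exact hρ''.ae_eq hT hac (fun t => (ha0 t).le) hlin t ht
end
end

section
/- Let ρ0∈L¹(0,1) and u∈L¹(0,T) be nonnegative a.e., set M:=‖u‖_{L¹(0,T)}+‖ρ0‖_{L¹(0,1)}, and suppose 0<δ<T and δ<1/λ̄(M). Then the map F defined by F(ξ)(t):=∫₀ᵗ λ(∫₀ˢ u(σ)dσ + ∫₀^{1−ξ(s)} ρ0(x)dx) ds maps the set Ω_{δ,M} into itself. -/
open MeasureTheory Set intervalIntegral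

noncomputable section

/-- `λ̃(M) = inf_{0 ≤ W ≤ M} λ(W)`. -/
def lamInf (lam : ℝ → ℝ) (M : ℝ) : ℝ := sInf (lam '' Set.Icc 0 M)

/-- `λ̄(M) = sup_{0 ≤ W ≤ M} λ(W)`. -/
def lamSup (lam : ℝ → ℝ) (M : ℝ) : ℝ := sSup (lam '' Set.Icc 0 M)

/-- `d(M) = sup_{0 ≤ W ≤ M} |λ'(W)|`. -/
def lamD (lam : ℝ → ℝ) (M : ℝ) : ℝ := sSup ((fun w => |deriv lam w|) '' Set.Icc 0 M)

/-- The set `Ω_{δ,M}` of continuous `ξ` on `[0,δ]` with `ξ(0) = 0` and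
difference quotients between `λ̃(M)` and `λ̄(M)`. -/
def Omega (lam : ℝ → ℝ) (δ M : ℝ) : Set (ℝ → ℝ) :=
  {ξ | ContinuousOn ξ (Set.Icc 0 δ) ∧ ξ 0 = 0 ∧
    ∀ t ∈ Set.Icc (0:ℝ) δ, ∀ s ∈ Set.Icc (0:ℝ) δ, t < s →
      lamInf lam M ≤ (ξ s - ξ t) / (s - t) ∧ (ξ s - ξ t) / (s - t) ≤ lamSup lam M}

/-- The map `F(ξ)(t) = ∫₀ᵗ λ(∫₀ˢ u(σ)dσ + ∫₀^{1-ξ(s)} ρ₀(x)dx) ds`. -/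
def Fmap (lam ρ₀ u : ℝ → ℝ) (ξ : ℝ → ℝ) (t : ℝ) : ℝ :=
  ∫ s in (0:ℝ)..t, lam ((∫ σ in (0:ℝ)..s, u σ) + ∫ x in (0:ℝ)..(1 - ξ s), ρ₀ x)

/-- The sup norm `‖f‖_{C⁰([0,δ])}`. -/
def supNorm (δ : ℝ) (f : ℝ → ℝ) : ℝ := sSup ((fun t => |f t|) '' Set.Icc 0 δ)

lemma intervalIntegral_mem_Icc_of_nonneg {f : ℝ → ℝ} {T s : ℝ}
    (hf : IntegrableOn f (Set.Ioc 0 T))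
    (hnn : ∀ᵐ x ∂(volume.restrict (Set.Ioc (0:ℝ) T)), 0 ≤ f x) (hs : s ∈ Set.Icc 0 T) :
    (∫ x in (0:ℝ)..s, f x) ∈ Set.Icc 0 (∫ x in (0:ℝ)..T, |f x|) := by
  have hsub : Set.Ioc 0 s ⊆ Set.Ioc 0 T := Set.Ioc_subset_Ioc_right hs.2
  rw [integral_of_le hs.1, integral_of_le (hs.1.trans hs.2)]
  refine ⟨integral_nonneg_of_ae (ae_restrict_of_ae_restrict_of_subset hsub hnn), ?_⟩
  calc ∫ x in Set.Ioc 0 s, f x ≤ ∫ x in Set.Ioc 0 T, f x :=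
        setIntegral_mono_set hf hnn hsub.eventuallyLE
    _ ≤ ∫ x in Set.Ioc 0 T, |f x| := integral_mono hf hf.abs fun x => le_abs_self _

lemma continuousOn_intervalIntegral_Icc {f : ℝ → ℝ} {T : ℝ} (hT : 0 ≤ T)
    (hf : IntegrableOn f (Set.Ioc 0 T)) :
    ContinuousOn (fun s => ∫ x in (0:ℝ)..s, f x) (Set.Icc 0 T) := by
  rw [← Set.uIcc_of_le hT]
  refine continuousOn_primitive_interval ?_
  rwa [Set.uIcc_of_le hT, integrableOn_Icc_iff_integrableOn_Ioc]

lemma mem_Icc_lamInf_lamSup {lam : ℝ → ℝ} (hlam : Continuous lam) {M w : ℝ}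
    (hw : w ∈ Set.Icc 0 M) : lam w ∈ Set.Icc (lamInf lam M) (lamSup lam M) := by
  have hK : IsCompact (lam '' Set.Icc 0 M) := isCompact_Icc.image hlam
  exact ⟨csInf_le hK.bddBelow (Set.mem_image_of_mem _ hw),
    le_csSup hK.bddAbove (Set.mem_image_of_mem _ hw)⟩

lemma lamInf_nonneg {lam : ℝ → ℝ} (hlam : ∀ w, 0 < lam w) (M : ℝ) : 0 ≤ lamInf lam M := by
  refine Real.sInf_nonneg ?_
  rintro _ ⟨w, -, rfl⟩
  exact (hlam w).le

lemma primitive_mem_Omega {lam g : ℝ → ℝ} {δ M : ℝ} (hδ : 0 ≤ δ)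
    (hg : ContinuousOn g (Set.Icc 0 δ))
    (hbd : ∀ s ∈ Set.Icc 0 δ, g s ∈ Set.Icc (lamInf lam M) (lamSup lam M)) :
    (fun t => ∫ s in (0:ℝ)..t, g s) ∈ Omega lam δ M := by
  refine ⟨continuousOn_intervalIntegral_Icc hδ
    (hg.integrableOn_Icc.mono_set Set.Ioc_subset_Icc_self), integral_same, ?_⟩
  intro t ht s hs hts
  have hint : ∀ a ∈ Set.Icc 0 δ, ∀ b ∈ Set.Icc 0 δ, IntervalIntegrable g volume a b :=
    fun a ha b hb => (hg.mono (Set.uIcc_subset_Icc ha hb)).intervalIntegrable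
  have h0 : (0:ℝ) ∈ Set.Icc 0 δ := ⟨le_rfl, hδ⟩
  have hmem : ∀ x ∈ Set.Icc t s, x ∈ Set.Icc 0 δ :=
    fun x hx => ⟨ht.1.trans hx.1, hx.2.trans hs.2⟩
  have hpos : 0 < s - t := sub_pos.2 hts
  simp only [integral_interval_sub_left (hint 0 h0 s hs) (hint 0 h0 t ht)]
  rw [le_div_iff₀ hpos, div_le_iff₀ hpos]
  constructor
  · have := integral_mono_on (f := fun _ => lamInf lam M) hts.le intervalIntegrable_const
      (hint t ht s hs) fun x hx => (hbd x (hmem x hx)).1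
    rwa [intervalIntegral.integral_const, smul_eq_mul, mul_comm] at this
  · have := integral_mono_on (g := fun _ => lamSup lam M) hts.le (hint t ht s hs)
      intervalIntegrable_const fun x hx => (hbd x (hmem x hx)).2
    rwa [intervalIntegral.integral_const, smul_eq_mul, mul_comm] at this

lemma Omega_mem_Icc {lam ξ : ℝ → ℝ} {δ M s : ℝ} (hξ : ξ ∈ Omega lam δ M)
    (hinf : 0 ≤ lamInf lam M) (hsup : 0 < lamSup lam M) (hδ : δ < 1 / lamSup lam M)
    (hs : s ∈ Set.Icc 0 δ) : ξ s ∈ Set.Icc 0 1 := by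
  obtain ⟨-, hξ0, hξq⟩ := hξ
  rcases hs.1.eq_or_lt with rfl | hpos
  · simp [hξ0]
  · obtain ⟨h1, h2⟩ := hξq 0 ⟨le_rfl, hs.1.trans hs.2⟩ s hs hpos
    rw [hξ0, sub_zero, sub_zero] at h1 h2
    rw [le_div_iff₀ hpos] at h1
    rw [div_le_iff₀ hpos] at h2
    rw [lt_div_iff₀ hsup] at hδ
    have h3 := mul_nonneg hinf hpos.le
    have h4 := mul_le_mul_of_nonneg_left hs.2 hsup.le
    constructor <;> linarith

/-- If `0 < δ < T`, `δ < 1/λ̄(M)` with `M = ‖u‖_{L¹(0,T)} + ‖ρ₀‖_{L¹(0,1)}`, then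
`F` maps `Ω_{δ,M}` into itself. -/
theorem Fmap_mapsTo_Omega
    (lam : ℝ → ℝ) (hlam : ContDiff ℝ 1 lam) (hlam_pos : ∀ w, 0 < lam w)
    (T : ℝ) (hT : 0 < T) (ρ₀ u : ℝ → ℝ)
    (hρ₀ : MeasureTheory.IntegrableOn ρ₀ (Set.Ioc 0 1))
    (hu : MeasureTheory.IntegrableOn u (Set.Ioc 0 T))
    (hρ₀nn : ∀ᵐ x ∂(volume.restrict (Set.Ioc (0:ℝ) 1)), 0 ≤ ρ₀ x)
    (hunn : ∀ᵐ t ∂(volume.restrict (Set.Ioc (0:ℝ) T)), 0 ≤ u t)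
    (M : ℝ) (hM : M = (∫ t in (0:ℝ)..T, |u t|) + ∫ x in (0:ℝ)..1, |ρ₀ x|)
    (δ : ℝ) (hδ0 : 0 < δ) (hδT : δ < T) (hδlam : δ < 1 / lamSup lam M)
    (ξ : ℝ → ℝ) (hξ : ξ ∈ Omega lam δ M) :
    Fmap lam ρ₀ u ξ ∈ Omega lam δ M := by
  have hM0 : 0 ≤ M := by
    rw [hM]
    exact add_nonneg (integral_nonneg hT.le fun x _ => abs_nonneg _)
      (integral_nonneg zero_le_one fun x _ => abs_nonneg _)
  have hsup : 0 < lamSup lam M :=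
    (hlam_pos 0).trans_le (mem_Icc_lamInf_lamSup hlam.continuous ⟨le_rfl, hM0⟩).2
  have hξI : ∀ s ∈ Set.Icc 0 δ, 1 - ξ s ∈ Set.Icc (0:ℝ) 1 := fun s hs => by
    obtain ⟨h1, h2⟩ := Omega_mem_Icc hξ (lamInf_nonneg hlam_pos M) hsup hδlam hs
    constructor <;> linarith
  have hsT : Set.Icc 0 δ ⊆ Set.Icc 0 T := Set.Icc_subset_Icc_right hδT.le
  refine primitive_mem_Omega hδ0.le (hlam.continuous.comp_continuousOn ?_) fun s hs =>
    mem_Icc_lamInf_lamSup hlam.continuous ?_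
  · exact ((continuousOn_intervalIntegral_Icc hT.le hu).mono hsT).add
      ((continuousOn_intervalIntegral_Icc zero_le_one hρ₀).comp
        (continuousOn_const.sub hξ.1) hξI)
  · obtain ⟨h1, h2⟩ := intervalIntegral_mem_Icc_of_nonneg hu hunn (hsT hs)
    obtain ⟨h3, h4⟩ := intervalIntegral_mem_Icc_of_nonneg hρ₀ hρ₀nn (hξI s hs)
    exact ⟨add_nonneg h1 h3, hM ▸ add_le_add h2 h4⟩
end
end

section
/- Let u∈L¹(0,T) be nonnegative a.e. and let ξ∈C¹([0,T]) be strictly increasing with ξ(0)=0 and λ̃(M)≤ξ'≤λ̄(M) for constants 0<λ̃(M)≤λ̄(M). Then for all 0≤t≤s≤T with ξ(s)≤1, one has ∫₀^{ξ(t)} ( ∫_{ξ^{-1}(ξ(t)−x)}^{ξ^{-1}(ξ(s)−x)} u(σ)dσ ) dx ≤ ‖u‖_{L¹(0,T)} · |ξ(s)−ξ(t)|. -/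
open MeasureTheory Set intervalIntegral

noncomputable section

/-- The increment of a monotone function `F` with values in `[0, C]`, integrated over a shift:
only the two end windows of length `q - p` contribute. -/
theorem integral_shift_sub_le_of_monotoneOn {F : ℝ → ℝ} {L C p q : ℝ}
    (hF : MonotoneOn F (Icc 0 L)) (h0 : ∀ y ∈ Icc 0 L, 0 ≤ F y) (hC : ∀ y ∈ Icc 0 L, F y ≤ C)
    (hp : 0 ≤ p) (hpq : p ≤ q) (hq : q ≤ L) :
    (∫ x in (0 : ℝ)..p, (F (q - x) - F (p - x))) ≤ C * (q - p) := by
  have hint : ∀ c d, 0 ≤ c → c ≤ d → d ≤ L → IntervalIntegrable F volume c d := by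
    intro c d hc hcd hd
    refine MonotoneOn.intervalIntegrable (hF.mono ?_)
    rw [uIcc_of_le hcd]
    exact Icc_subset_Icc hc hd
  have hiq : IntervalIntegrable (fun x => F (q - x)) volume 0 p := by
    simpa using ((hint (q - p) q (by linarith) (by linarith) hq).comp_sub_left q).symm
  have hip : IntervalIntegrable (fun x => F (p - x)) volume 0 p := by
    simpa using ((hint 0 p le_rfl hp (by linarith)).comp_sub_left p).symm
  rw [intervalIntegral.integral_sub hiq hip, intervalIntegral.integral_comp_sub_left F q,
    intervalIntegral.integral_comp_sub_left F p, sub_zero, sub_zero, sub_self]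
  have h1 := intervalIntegral.integral_add_adjacent_intervals
    (hint 0 (q - p) le_rfl (by linarith) (by linarith))
    (hint (q - p) q (by linarith) (by linarith) hq)
  have h2 := intervalIntegral.integral_add_adjacent_intervals
    (hint 0 p le_rfl hp (by linarith)) (hint p q hp hpq hq)
  have h3 : 0 ≤ ∫ x in (0 : ℝ)..(q - p), F x :=
    intervalIntegral.integral_nonneg (by linarith) fun x hx =>
      h0 x ⟨hx.1, by linarith [hx.2]⟩
  have h4 : (∫ x in p..q, F x) ≤ ∫ _ in p..q, C :=
    intervalIntegral.integral_mono_on hpq (hint p q hp hpq hq) (by simp) fun x hx =>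
      hC x ⟨hp.trans hx.1, hx.2.trans hq⟩
  rw [intervalIntegral.integral_const, smul_eq_mul] at h4
  linarith

/-- Estimate (2.25): for nonnegative `u ∈ L¹(0,T)` and a strictly increasing `C¹`
function `ξ` with `ξ(0) = 0` and `0 < λ̃(M) ≤ ξ' ≤ λ̄(M)`, for `0 ≤ t ≤ s ≤ T`
with `ξ(s) ≤ 1`,
`∫₀^{ξ(t)} ∫_{ξ⁻¹(ξ(t)-x)}^{ξ⁻¹(ξ(s)-x)} u(σ) dσ dx ≤ ‖u‖_{L¹(0,T)} |ξ(s) - ξ(t)|`. -/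
theorem double_integral_u_estimate
    (T : ℝ) (hT : 0 < T) (u : ℝ → ℝ)
    (hu : MeasureTheory.IntegrableOn u (Set.Ioc 0 T))
    (hunn : ∀ᵐ t ∂(volume.restrict (Set.Ioc (0:ℝ) T)), 0 ≤ u t)
    (a b : ℝ) (hab : 0 < a) (hba : a ≤ b)
    (ξ dξ ξinv : ℝ → ℝ)
    (hξ0 : ξ 0 = 0)
    (hmono : StrictMonoOn ξ (Set.Icc 0 T))
    (hderiv : ∀ t ∈ Set.Icc (0:ℝ) T, HasDerivWithinAt ξ (dξ t) (Set.Icc 0 T) t)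
    (hdcont : ContinuousOn dξ (Set.Icc 0 T))
    (hdbound : ∀ t ∈ Set.Icc (0:ℝ) T, a ≤ dξ t ∧ dξ t ≤ b)
    (hinv1 : ∀ t ∈ Set.Icc (0:ℝ) T, ξinv (ξ t) = t)
    (hinv2 : ∀ y ∈ Set.Icc (0:ℝ) (ξ T), ξ (ξinv y) = y ∧ ξinv y ∈ Set.Icc (0:ℝ) T)
    (t s : ℝ) (ht : 0 ≤ t) (hts : t ≤ s) (hsT : s ≤ T) (hξs : ξ s ≤ 1) :
    (∫ x in (0:ℝ)..(ξ t), ∫ σ in (ξinv (ξ t - x))..(ξinv (ξ s - x)), u σ)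
      ≤ (∫ σ in (0:ℝ)..T, |u σ|) * |ξ s - ξ t| := by
  have hnn : ∀ α β, 0 ≤ α → α ≤ β → β ≤ T → 0 ≤ ∫ σ in α..β, u σ := by
    intro α β hα hαβ hβ
    rw [intervalIntegral.integral_of_le hαβ]
    exact integral_nonneg_of_ae
      (ae_restrict_of_ae_restrict_of_subset (Ioc_subset_Ioc hα hβ) hunn)
  have hint : ∀ α β, 0 ≤ α → α ≤ β → β ≤ T → IntervalIntegrable u volume α β := by
    intro α β hα hαβ hβ
    rw [intervalIntegrable_iff_integrableOn_Ioc_of_le hαβ]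
    exact hu.mono_set (Ioc_subset_Ioc hα hβ)
  have habs : (∫ σ in (0 : ℝ)..T, |u σ|) = ∫ σ in (0 : ℝ)..T, u σ := by
    rw [intervalIntegral.integral_of_le hT.le, intervalIntegral.integral_of_le hT.le]
    exact integral_congr_ae (hunn.mono fun x hx => abs_of_nonneg hx)
  have htm : t ∈ Icc 0 T := ⟨ht, hts.trans hsT⟩
  have hsm : s ∈ Icc 0 T := ⟨ht.trans hts, hsT⟩
  have h0m : (0 : ℝ) ∈ Icc 0 T := ⟨le_rfl, hT.le⟩
  have hTm : T ∈ Icc 0 T := ⟨hT.le, le_rfl⟩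
  have hξt : 0 ≤ ξ t := hξ0 ▸ hmono.monotoneOn h0m htm ht
  have hξts : ξ t ≤ ξ s := hmono.monotoneOn htm hsm hts
  have hξsT : ξ s ≤ ξ T := hmono.monotoneOn hsm hTm hsT
  have hinvmono : MonotoneOn ξinv (Icc 0 (ξ T)) := by
    intro y hy z hz hyz
    rw [← hmono.le_iff_le (hinv2 y hy).2 (hinv2 z hz).2, (hinv2 y hy).1, (hinv2 z hz).1]
    exact hyz
  have hadd : ∀ α β, 0 ≤ α → α ≤ β → β ≤ T →
      (∫ σ in (0 : ℝ)..α, u σ) + (∫ σ in α..β, u σ) = ∫ σ in (0 : ℝ)..β, u σ :=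
    fun α β hα hαβ hβ => intervalIntegral.integral_add_adjacent_intervals
      (hint 0 α le_rfl hα (hαβ.trans hβ)) (hint α β hα hαβ hβ)
  have hle : ∀ α β, 0 ≤ α → α ≤ β → β ≤ T →
      (∫ σ in (0 : ℝ)..α, u σ) ≤ ∫ σ in (0 : ℝ)..β, u σ := fun α β hα hαβ hβ => by
    linarith [hadd α β hα hαβ hβ, hnn α β hα hαβ hβ]
  have hshift := integral_shift_sub_le_of_monotoneOn
    (F := fun y => ∫ σ in (0 : ℝ)..ξinv y, u σ) (C := ∫ σ in (0 : ℝ)..T, u σ)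
    (fun y hy z hz hyz =>
      hle _ _ (hinv2 y hy).2.1 (hinvmono hy hz hyz) (hinv2 z hz).2.2)
    (fun y hy => hnn _ _ le_rfl (hinv2 y hy).2.1 (hinv2 y hy).2.2)
    (fun y hy => hle _ _ (hinv2 y hy).2.1 (hinv2 y hy).2.2 le_rfl) hξt hξts hξsT
  rw [habs, abs_of_nonneg (sub_nonneg.2 hξts)]
  refine le_of_eq_of_le (intervalIntegral.integral_congr fun x hx => ?_) hshift
  rw [uIcc_of_le hξt] at hx
  have hxt : ξ t - x ∈ Icc 0 (ξ T) := ⟨by linarith [hx.2], by linarith [hx.1]⟩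
  have hxs : ξ s - x ∈ Icc 0 (ξ T) := ⟨by linarith [hx.2], by linarith [hx.1]⟩
  exact eq_sub_of_add_eq' (hadd _ _ (hinv2 _ hxt).2.1
    (hinvmono hxt hxs (by linarith)) (hinv2 _ hxs).2.2)
end
end

section
/- Let ρ0∈L¹(0,1) and u∈L¹(0,T) be nonnegative a.e., let ξ∈C¹([0,δ]) be the fixed point of F(ξ)(t)=∫₀ᵗ λ(∫₀ˢ u + ∫₀^{1−ξ(s)} ρ0) ds in Ω_{δ,M} with M=‖u‖_{L¹(0,T)}+‖ρ0‖_{L¹(0,1)}, and define ρ(t,x):=ρ0(x−ξ(t)) for 0≤ξ(t)≤x≤1 and ρ(t,x):=u(ξ^{-1}(ξ(t)−x))/ξ'(ξ^{-1}(ξ(t)−x)) for 0≤x≤ξ(t)≤1. Then the map t ↦ ρ(t,·) belongs to C⁰([0,δ];L¹(0,1)), i.e., ∫₀¹|ρ(s,x)−ρ(t,x)|dx → 0 as s→t for s,t∈[0,δ]. -/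
open MeasureTheory Set intervalIntegral

noncomputable section

/-- The function transported along the characteristic curve `x = ξ(t)`:
`ρ(t,x) = ρ₀(x - ξ(t))` for `x ≥ ξ(t)`, and
`ρ(t,x) = u(ξ⁻¹(ξ(t)-x)) / ξ'(ξ⁻¹(ξ(t)-x))` for `x ≤ ξ(t)`. -/
def transportSol (ρ₀ u ξ dξ ξinv : ℝ → ℝ) (t x : ℝ) : ℝ :=
  if ξ t ≤ x then ρ₀ (x - ξ t) else u (ξinv (ξ t - x)) / dξ (ξinv (ξ t - x))

/-- Translation is continuous in `L¹(ℝ)`. -/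
theorem tendsto_integral_abs_translate_sub {g : ℝ → ℝ} (hg : Integrable g) (c₀ : ℝ) :
    Filter.Tendsto (fun c : ℝ => ∫ x, |g (c + x) - g (c₀ + x)|) (nhds c₀) (nhds 0) := by
  have hp : MemLp g 1 volume := memLp_one_iff_integrable.2 hg
  have : Fact ((1 : ENNReal) ≠ ⊤) := ⟨ENNReal.one_ne_top⟩
  have hcont : Continuous fun c : ℝ => DomAddAct.mk c +ᵥ hp.toLp g :=
    (DomAddAct.continuous_mk).vadd continuous_const
  have hlim := tendsto_iff_dist_tendsto_zero.1 (hcont.tendsto c₀)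
  refine hlim.congr fun c => ?_
  rw [DomAddAct.mk_vadd_toLp, DomAddAct.mk_vadd_toLp, dist_eq_norm, ← MemLp.toLp_sub,
    L1.norm_eq_integral_norm]
  refine integral_congr_ae ?_
  filter_upwards [MemLp.coeFn_toLp ((hp.comp_measurePreserving
    (measurePreserving_vadd c volume)).sub (hp.comp_measurePreserving
    (measurePreserving_vadd c₀ volume)))] with x hx
  exact congrArg norm hx

/-- The profile `g` with `ρ(t,x) = g(x - ξ(t))`, cut off to the values of `x - ξ(t)` that occur
for `x ∈ [0,1]` and `t ∈ [0,δ]`. -/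
def transportProfile (ρ₀ u ξ dξ ξinv : ℝ → ℝ) (δ : ℝ) : ℝ → ℝ :=
  (Icc 0 1).indicator ρ₀ +
    (Ico (-ξ δ) 0).indicator (fun y => u (ξinv (-y)) / dξ (ξinv (-y)))

theorem transportSol_eq_transportProfile {ρ₀ u ξ dξ ξinv : ℝ → ℝ} {δ t x : ℝ}
    (h0 : 0 ≤ ξ t) (hδ : ξ t ≤ ξ δ) (hx : x ∈ Ioc (0 : ℝ) 1) :
    transportSol ρ₀ u ξ dξ ξinv t x = transportProfile ρ₀ u ξ dξ ξinv δ (-ξ t + x) := by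
  obtain ⟨hx0, hx1⟩ := hx
  simp only [transportSol, transportProfile, Pi.add_apply]
  split_ifs with h
  · rw [indicator_of_mem (show _ ∈ Icc _ _ from ⟨by linarith, by linarith⟩),
      indicator_of_notMem fun hy => by linarith [hy.2], add_zero, sub_eq_neg_add]
  · rw [indicator_of_notMem fun hy => h (by linarith [hy.1]),
      indicator_of_mem (show _ ∈ Ico _ _ from ⟨by linarith, by linarith⟩), zero_add,
      show -(-ξ t + x) = ξ t - x by ring]

theorem integrable_transportProfile {ρ₀ u ξ dξ ξinv : ℝ → ℝ} {δ : ℝ}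
    (hρ₀ : IntegrableOn ρ₀ (Icc 0 1)) (hu : IntegrableOn u (Icc 0 δ))
    (hmono : StrictMonoOn ξ (Icc 0 δ)) (hpos : ∀ t ∈ Icc (0 : ℝ) δ, 0 < dξ t)
    (hderiv : ∀ t ∈ Icc (0 : ℝ) δ, HasDerivWithinAt ξ (dξ t) (Icc 0 δ) t)
    (hinv1 : ∀ t ∈ Icc (0 : ℝ) δ, ξinv (ξ t) = t)
    (hinv2 : ∀ y ∈ Icc (0 : ℝ) (ξ δ), ξ (ξinv y) = y ∧ ξinv y ∈ Icc (0 : ℝ) δ) :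
    Integrable (transportProfile ρ₀ u ξ dξ ξinv δ) := by
  refine ((integrable_indicator_iff measurableSet_Icc).2 hρ₀).add
    ((integrable_indicator_iff measurableSet_Ico).2 ?_)
  have hsub : Ico (-ξ δ) 0 ⊆ (fun t => -ξ t) '' Icc 0 δ := fun y hy => by
    obtain ⟨h1, h2⟩ := hinv2 (-y) ⟨by linarith [hy.2], by linarith [hy.1]⟩
    exact ⟨_, h2, by simp [h1]⟩
  refine IntegrableOn.mono_set ?_ hsub
  rw [integrableOn_image_iff_integrableOn_abs_deriv_smul (f := fun t => -ξ t) measurableSet_Icc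
    (fun t ht => (hderiv t ht).neg) fun a ha b hb hab => hmono.injOn ha hb (neg_injective hab)]
  refine hu.congr_fun (fun t ht => ?_) measurableSet_Icc
  have := hpos t ht
  simp only [neg_neg, abs_neg, smul_eq_mul, hinv1 t ht, abs_of_pos this]
  field_simp

/-- For `ξ` the fixed point of `F` in `Ω_{δ,M}`, the transported solution `ρ` is
continuous in time with values in `L¹(0,1)`:
`∫₀¹ |ρ(s,x) - ρ(t,x)| dx → 0` as `s → t`. -/
theorem transport_continuous_in_L1
    (lam : ℝ → ℝ) (hlam : ContDiff ℝ 1 lam) (hlam_pos : ∀ w, 0 < lam w)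
    (T : ℝ) (hT : 0 < T) (ρ₀ u : ℝ → ℝ)
    (hρ₀ : MeasureTheory.IntegrableOn ρ₀ (Set.Ioc 0 1))
    (hu : MeasureTheory.IntegrableOn u (Set.Ioc 0 T))
    (hρ₀nn : ∀ᵐ x ∂(volume.restrict (Set.Ioc (0:ℝ) 1)), 0 ≤ ρ₀ x)
    (hunn : ∀ᵐ t ∂(volume.restrict (Set.Ioc (0:ℝ) T)), 0 ≤ u t)
    (M : ℝ) (hM : M = (∫ t in (0:ℝ)..T, |u t|) + ∫ x in (0:ℝ)..1, |ρ₀ x|)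
    (δ : ℝ) (hδ0 : 0 < δ) (hδT : δ ≤ T) (hδlam : δ < 1 / lamSup lam M)
    (ξ dξ ξinv : ℝ → ℝ)
    (hξ : ξ ∈ Omega lam δ M)
    (hfix : ∀ t ∈ Set.Icc (0:ℝ) δ, Fmap lam ρ₀ u ξ t = ξ t)
    (hmono : StrictMonoOn ξ (Set.Icc 0 δ)) (hξδ : ξ δ ≤ 1)
    (hdξ : ∀ t ∈ Set.Icc (0:ℝ) δ,
        dξ t = lam ((∫ σ in (0:ℝ)..t, u σ) + ∫ x in (0:ℝ)..(1 - ξ t), ρ₀ x))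
    (hderiv : ∀ t ∈ Set.Icc (0:ℝ) δ, HasDerivWithinAt ξ (dξ t) (Set.Icc 0 δ) t)
    (hinv1 : ∀ t ∈ Set.Icc (0:ℝ) δ, ξinv (ξ t) = t)
    (hinv2 : ∀ y ∈ Set.Icc (0:ℝ) (ξ δ), ξ (ξinv y) = y ∧ ξinv y ∈ Set.Icc (0:ℝ) δ) :
    ∀ t ∈ Set.Icc (0:ℝ) δ, ∀ ε > (0:ℝ), ∃ η > (0:ℝ), ∀ s ∈ Set.Icc (0:ℝ) δ,
      |s - t| < η →
        (∫ x in Set.Ioc (0:ℝ) 1,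
            |transportSol ρ₀ u ξ dξ ξinv s x - transportSol ρ₀ u ξ dξ ξinv t x|) < ε := by
  intro t ht ε hε
  obtain ⟨hcont, hξ0, -⟩ := hξ
  have hnonneg : ∀ r ∈ Icc (0 : ℝ) δ, 0 ≤ ξ r := fun r hr =>
    hξ0 ▸ hmono.monotoneOn ⟨le_rfl, hδ0.le⟩ hr hr.1
  have hle : ∀ r ∈ Icc (0 : ℝ) δ, ξ r ≤ ξ δ := fun r hr =>
    hmono.monotoneOn hr ⟨hδ0.le, le_rfl⟩ hr.2
  have hg : Integrable (transportProfile ρ₀ u ξ dξ ξinv δ) :=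
    integrable_transportProfile ((integrableOn_Icc_iff_integrableOn_Ioc (by simp)).2 hρ₀)
      ((integrableOn_Icc_iff_integrableOn_Ioc (by simp)).2 (hu.mono_set (Ioc_subset_Ioc_right hδT)))
      hmono (fun r hr => hdξ r hr ▸ hlam_pos _) hderiv hinv1 hinv2
  have hlim := (tendsto_integral_abs_translate_sub hg (-ξ t)).comp (hcont t ht).neg
  obtain ⟨η, hη, H⟩ := Metric.mem_nhdsWithin_iff.1 (hlim.eventually (gt_mem_nhds hε))
  refine ⟨η, hη, fun s hs hst => lt_of_le_of_lt ?_ (H ⟨hst, hs⟩)⟩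
  rw [setIntegral_congr_fun measurableSet_Ioc fun x hx => by
    rw [transportSol_eq_transportProfile (hnonneg s hs) (hle s hs) hx,
      transportSol_eq_transportProfile (hnonneg t ht) (hle t ht) hx]]
  exact setIntegral_le_integral ((hg.comp_add_left _).sub (hg.comp_add_left _)).abs
    (Filter.Eventually.of_forall fun x => abs_nonneg _)
end
end

section
/- Let ρ0∈L¹(0,1) and u∈L¹(0,T) be nonnegative a.e., M:=‖u‖_{L¹(0,T)}+‖ρ0‖_{L¹(0,1)}, and let ρ̄∈C⁰([0,δ];L¹(0,1)) be any weak solution of the Cauchy problem on [0,δ], with W̄(t):=∫₀¹ρ̄(t,x)dx and ξ̄(t):=∫₀ᵗ λ(W̄(s))ds, where δ>0 is small enough that ξ̄(δ)≤1 and F is a contraction of Ω_{δ,M}. Then ξ̄ satisfies ξ̄(t) = ∫₀ᵗ λ(∫₀ˢ u(σ)dσ + ∫₀^{1−ξ̄(s)} ρ0(y)dy) ds for all t∈[0,δ], i.e., ξ̄ is a fixed point of the map F; consequently the weak solution on [0,δ] is unique. -/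
open MeasureTheory Set intervalIntegral

noncomputable section

open Filter Topology

theorem IsWeakSolution.tendsto_integral_abs_sub {lam : ℝ → ℝ} {δ : ℝ} {ρ₀ u : ℝ → ℝ}
    {ρ : ℝ → ℝ → ℝ} (h : IsWeakSolution lam δ ρ₀ u ρ) {t : ℝ} (ht : t ∈ Icc 0 δ) :
    Tendsto (fun s => ∫ x in Ioc (0:ℝ) 1, |ρ s x - ρ t x|) (𝓝[Icc 0 δ] t) (𝓝 0) := by
  rw [Metric.tendsto_nhdsWithin_nhds]
  intro ε hε
  obtain ⟨η, hη, H⟩ := h.2.1 t ht ε hε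
  refine ⟨η, hη, fun {s} hs hd => ?_⟩
  rw [Real.dist_0_eq_abs, abs_of_nonneg (integral_nonneg fun x => abs_nonneg _)]
  exact H s hs hd

theorem IsWeakSolution.continuousOn_integral_mul {lam : ℝ → ℝ} {δ : ℝ} {ρ₀ u : ℝ → ℝ}
    {ρ : ℝ → ℝ → ℝ} (h : IsWeakSolution lam δ ρ₀ u ρ) {X G : ℝ → ℝ} (hX : Continuous X)
    (hG : Continuous G) {C : ℝ} (hC : ∀ y, |G y| ≤ C) :
    ContinuousOn (fun s => ∫ x in Ioc (0:ℝ) 1, ρ s x * G (x - X s)) (Icc 0 δ) := by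
  intro t ht
  have hint : ∀ r ∈ Icc 0 δ, ∀ s, IntegrableOn (fun x => ρ r x * G (x - X s)) (Ioc 0 1) :=
    fun r hr s => (h.1 r hr).mul_bdd (c := C)
      (hG.comp (continuous_id.sub continuous_const)).aestronglyMeasurable
      (Eventually.of_forall fun x => hC _)
  have hB : Continuous fun s => ∫ x in Ioc (0:ℝ) 1, ρ t x * G (x - X s) := by
    refine continuous_of_dominated (bound := fun x => |ρ t x| * C)
      (fun s => (hint t ht s).aestronglyMeasurable)
      (fun s => Eventually.of_forall fun x => ?_) ((h.1 t ht).abs.mul_const C)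
      (Eventually.of_forall fun x => by fun_prop)
    rw [norm_mul]
    exact mul_le_mul_of_nonneg_left (hC _) (abs_nonneg _)
  have hD : Tendsto (fun s => ∫ x in Ioc (0:ℝ) 1, (ρ s x - ρ t x) * G (x - X s))
      (𝓝[Icc 0 δ] t) (𝓝 0) := by
    refine squeeze_zero_norm' (a := fun s => (∫ x in Ioc (0:ℝ) 1, |ρ s x - ρ t x|) * C) ?_
      (by simpa using (h.tendsto_integral_abs_sub ht).mul_const C)
    filter_upwards [self_mem_nhdsWithin] with s hs
    rw [← MeasureTheory.integral_mul_const]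
    refine norm_integral_le_of_norm_le (((h.1 s hs).sub (h.1 t ht)).abs.mul_const C)
      (Eventually.of_forall fun x => ?_)
    rw [norm_mul]
    exact mul_le_mul_of_nonneg_left (hC _) (abs_nonneg _)
  have := hD.add (hB.continuousAt.continuousWithinAt (s := Icc 0 δ)).tendsto
  rw [zero_add] at this
  refine this.congr' ?_
  filter_upwards [self_mem_nhdsWithin] with s hs
  have h2 := integral_sub (hint s hs s) (hint t ht s)
  simp only [sub_mul]
  rw [h2]; ring

theorem IsWeakSolution.continuousOn_mass {lam : ℝ → ℝ} {δ : ℝ} {ρ₀ u : ℝ → ℝ}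
    {ρ : ℝ → ℝ → ℝ} (h : IsWeakSolution lam δ ρ₀ u ρ) :
    ContinuousOn (fun s => ∫ x in Ioc (0:ℝ) 1, ρ s x) (Icc 0 δ) := by
  simpa using h.continuousOn_integral_mul (X := fun _ => 0) (G := fun _ => 1) (C := 1)
    continuous_const continuous_const (by simp)

/-- The characteristic curve of a weak solution extends to a `C¹` strictly monotone function on the
whole line. -/
theorem IsWeakSolution.exists_characteristic {lam : ℝ → ℝ} (hlam : Continuous lam)
    (hpos : ∀ w, 0 < lam w) {δ : ℝ} (hδ : 0 ≤ δ) {ρ₀ u : ℝ → ℝ}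
    {ρ : ℝ → ℝ → ℝ} (h : IsWeakSolution lam δ ρ₀ u ρ) :
    ∃ X : ℝ → ℝ, ContDiff ℝ 1 X ∧ StrictMono X ∧ X 0 = 0 ∧
      (∀ t ∈ Icc 0 δ, HasDerivAt X (lam (∫ x in Ioc (0:ℝ) 1, ρ t x)) t) ∧
      ∀ t ∈ Icc 0 δ, X t = ∫ s in (0:ℝ)..t, lam (∫ x in Ioc (0:ℝ) 1, ρ s x) := by
  set v : ℝ → ℝ := IccExtend hδ ((Icc 0 δ).domRestrict fun s => lam (∫ x in Ioc (0:ℝ) 1, ρ s x))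
  have hv : Continuous v :=
    (continuousOn_iff_continuous_domRestrict.1 (hlam.comp_continuousOn h.continuousOn_mass)).Icc_extend'
  have hveq : ∀ t ∈ Icc 0 δ, v t = lam (∫ x in Ioc (0:ℝ) 1, ρ t x) := fun t ht =>
    IccExtend_of_mem hδ _ ht
  have hvpos : ∀ t, 0 < v t := fun t => hpos _
  have hd : ∀ t, HasDerivAt (fun t => ∫ s in (0:ℝ)..t, v s) (v t) t := fun t =>
    hv.integral_hasStrictDerivAt 0 t |>.hasDerivAt
  refine ⟨fun t => ∫ s in (0:ℝ)..t, v s, ?_, ?_, by simp, ?_, ?_⟩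
  · rw [contDiff_one_iff_deriv]
    refine ⟨fun t => (hd t).differentiableAt, ?_⟩
    rwa [show deriv (fun t => ∫ s in (0:ℝ)..t, v s) = v from funext fun t => (hd t).deriv]
  · exact strictMono_of_deriv_pos fun t => by rw [(hd t).deriv]; exact hvpos t
  · intro t ht
    rw [← hveq t ht]
    exact hd t
  · intro t ht
    refine intervalIntegral.integral_congr fun s hs => hveq s ?_
    rw [uIcc_of_le ht.1] at hs
    exact ⟨hs.1, hs.2.trans ht.2⟩

theorem integral_sub_mul_eq_integral_primitive {f : ℝ → ℝ} {τ : ℝ} (hτ : 0 ≤ τ)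
    (hf : IntegrableOn f (Ioc 0 τ)) :
    ∫ s in (0:ℝ)..τ, (τ - s) * f s = ∫ r in (0:ℝ)..τ, ∫ s in (0:ℝ)..r, f s := by
  have hI : Integrable (Function.uncurry fun r s : ℝ => (Iic r).indicator f s)
      ((volume.restrict (Ioc 0 τ)).prod (volume.restrict (Ioc 0 τ))) := by
    have := (hf.comp_snd (volume.restrict (Ioc 0 τ))).indicator
      (measurableSet_le measurable_snd measurable_fst)
    exact this
  have hswap := integral_integral_swap hI
  rw [intervalIntegral.integral_of_le hτ, intervalIntegral.integral_of_le hτ]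
  calc ∫ s in Ioc 0 τ, (τ - s) * f s
      = ∫ s in Ioc 0 τ, ∫ r in Ioc 0 τ, (Iic r).indicator f s := by
        refine setIntegral_congr_fun measurableSet_Ioc fun s hs => ?_
        have : (fun r => (Iic r).indicator f s) = (Ici s).indicator fun _ => f s := by
          ext r; simp [indicator_apply]
        simp only [this]
        rw [setIntegral_indicator measurableSet_Ici, setIntegral_const,
          show Ioc 0 τ ∩ Ici s = Icc s τ by
            ext r; simp only [mem_inter_iff, mem_Ioc, mem_Ici, mem_Icc]
            exact ⟨fun h => ⟨h.2, h.1.2⟩, fun h => ⟨⟨hs.1.trans_le h.1, h.2⟩, h.1⟩⟩]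
        simp [Measure.real, hs.2]
    _ = ∫ r in Ioc 0 τ, ∫ s in Ioc 0 τ, (Iic r).indicator f s := hswap.symm
    _ = ∫ r in Ioc 0 τ, ∫ s in (0:ℝ)..r, f s := by
        refine setIntegral_congr_fun measurableSet_Ioc fun r hr => ?_
        rw [setIntegral_indicator measurableSet_Iic, intervalIntegral.integral_of_le hr.1.le,
          Ioc_inter_Iic, min_eq_right hr.2]

theorem ContinuousOn.eqOn_zero_of_integral_eq_zero {f : ℝ → ℝ} {τ : ℝ} (hτ : 0 < τ)
    (hf : ContinuousOn f (Icc 0 τ)) (h : ∀ t ∈ Icc 0 τ, ∫ s in (0:ℝ)..t, f s = 0) :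
    ∀ t ∈ Icc 0 τ, f t = 0 := by
  intro t ht
  set g := IccExtend hτ.le ((Icc 0 τ).domRestrict f)
  have hg : Continuous g := (continuousOn_iff_continuous_domRestrict.1 hf).Icc_extend'
  have hgf : ∀ s ∈ Icc 0 τ, g s = f s := fun s hs => IccExtend_of_mem hτ.le _ hs
  have h1 : HasDerivWithinAt (fun r => ∫ s in (0:ℝ)..r, g s) (g t) (Icc 0 τ) t :=
    (hg.integral_hasStrictDerivAt 0 t).hasDerivAt.hasDerivWithinAt
  have h0 : ∀ r ∈ Icc 0 τ, ∫ s in (0:ℝ)..r, g s = 0 := fun r hr => by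
    refine (intervalIntegral.integral_congr fun s hs => hgf s ?_).trans (h r hr)
    rw [uIcc_of_le hr.1] at hs
    exact ⟨hs.1, hs.2.trans hr.2⟩
  have h2 : HasDerivWithinAt (fun r => ∫ s in (0:ℝ)..r, g s) 0 (Icc 0 τ) t :=
    (hasDerivWithinAt_const t _ (0:ℝ)).congr h0 (h0 t ht)
  rw [← hgf t ht]
  exact (uniqueDiffOn_Icc hτ t ht).eq_deriv _ h1 h2

/-- A weak solution is transported along its characteristics: testing against
`φ(s, x) = (τ - s) G(x - X(s))` and differentiating in `τ`. -/
theorem IsWeakSolution.integral_mul_comp_characteristic {lam : ℝ → ℝ} {δ : ℝ}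
    {ρ₀ u : ℝ → ℝ} (hu : IntegrableOn u (Ioc 0 δ)) {ρ : ℝ → ℝ → ℝ}
    (h : IsWeakSolution lam δ ρ₀ u ρ) {X : ℝ → ℝ} (hX : ContDiff ℝ 1 X) (hXm : StrictMono X)
    (hX0 : X 0 = 0) (hXd : ∀ t ∈ Icc 0 δ, HasDerivAt X (lam (∫ x in Ioc (0:ℝ) 1, ρ t x)) t)
    {G : ℝ → ℝ} (hG : ContDiff ℝ 1 G) {C : ℝ} (hC : ∀ y, |G y| ≤ C)
    {τ : ℝ} (hτ0 : 0 < τ) (hτ : τ ≤ δ) (hGz : ∀ y, 1 - X τ ≤ y → G y = 0) :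
    ∫ x in Ioc (0:ℝ) 1, ρ τ x * G (x - X τ)
      = (∫ s in Ioc (0:ℝ) τ, u s * G (-X s)) + ∫ x in Ioc (0:ℝ) 1, ρ₀ x * G x := by
  set f : ℝ → ℝ := fun s => u s * G (-X s) with hf_def
  set c := ∫ x in Ioc (0:ℝ) 1, ρ₀ x * G x with hc
  set H : ℝ → ℝ := fun s => ∫ x in Ioc (0:ℝ) 1, ρ s x * G (x - X s) with hH
  have hf : IntegrableOn f (Ioc 0 δ) := hu.mul_bdd (c := C)
    (hG.continuous.comp hX.continuous.neg).aestronglyMeasurable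
    (Eventually.of_forall fun x => hC _)
  have hHc : ContinuousOn H (Icc 0 τ) :=
    (h.continuousOn_integral_mul hX.continuous hG.continuous hC).mono (Icc_subset_Icc_right hτ)
  have hPc : ContinuousOn (fun r => ∫ s in (0:ℝ)..r, f s) (Icc 0 τ) := by
    have := intervalIntegral.continuousOn_primitive_interval (μ := volume) (f := f) (a := 0) (b := τ)
      (by rw [uIcc_of_le hτ0.le, integrableOn_Icc_iff_integrableOn_Ioc]
          exact hf.mono_set (Ioc_subset_Ioc_right hτ))
    rwa [uIcc_of_le hτ0.le] at this
  have key : ∀ r ∈ Icc 0 τ, ∫ s in (0:ℝ)..r, H s - ((∫ σ in (0:ℝ)..s, f σ) + c) = 0 := by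
    intro r hr
    have hrδ : r ∈ Icc 0 δ := ⟨hr.1, hr.2.trans hτ⟩
    have hw := h.2.2 r hrδ (fun s x => (r - s) * G (x - X s)) (by fun_prop) (by simp)
      (fun t ht => by
        rw [hGz _ (by linarith [hXm.monotone (ht.2.trans hr.2)]), mul_zero])
    have hsub : uIcc 0 r ⊆ Icc 0 τ := by
      rw [uIcc_of_le hr.1]; exact Icc_subset_Icc_right hr.2
    have e1 : (∫ t in Ioc (0:ℝ) r, ∫ x in Ioc (0:ℝ) 1,
          ρ t x * (deriv (fun s => (r - s) * G (x - X s)) t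
            + lam (∫ y in Ioc (0:ℝ) 1, ρ t y) * deriv (fun x => (r - t) * G (x - X t)) x))
        = - ∫ s in (0:ℝ)..r, H s := by
      rw [intervalIntegral.integral_of_le hr.1, ← MeasureTheory.integral_neg]
      refine setIntegral_congr_fun measurableSet_Ioc fun t ht => ?_
      simp only [hH]
      rw [← MeasureTheory.integral_neg]
      refine integral_congr_ae (Eventually.of_forall fun x => ?_)
      have hGd : HasDerivAt G (deriv G (x - X t)) (x - X t) :=
        (hG.differentiable one_ne_zero _).hasDerivAt
      have d1 : HasDerivAt (fun s => (r - s) * G (x - X s)) _ t :=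
        ((hasDerivAt_id t).const_sub r).mul
          (hGd.comp t ((hXd t ⟨ht.1.le, ht.2.trans hrδ.2⟩).const_sub x))
      have d2 : HasDerivAt (fun x => (r - t) * G (x - X t)) _ x :=
        (hGd.comp x ((hasDerivAt_id x).sub_const (X t))).const_mul (r - t)
      simp only
      rw [d1.deriv, d2.deriv]
      simp only [id]
      ring
    have e2 : (∫ t in Ioc (0:ℝ) r, u t * ((r - t) * G (0 - X t)))
        = ∫ s in (0:ℝ)..r, ∫ σ in (0:ℝ)..s, f σ := by
      rw [← integral_sub_mul_eq_integral_primitive hr.1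
        (hf.mono_set (Ioc_subset_Ioc_right hrδ.2)), intervalIntegral.integral_of_le hr.1]
      refine integral_congr_ae (Eventually.of_forall fun t => ?_)
      simp only [hf_def, zero_sub]
      ring
    have e3 : (∫ x in Ioc (0:ℝ) 1, ρ₀ x * ((r - 0) * G (x - X 0))) = r * c := by
      rw [hc, ← MeasureTheory.integral_const_mul]
      refine integral_congr_ae (Eventually.of_forall fun t => ?_)
      simp only [hX0, sub_zero]
      ring
    rw [e1, e2, e3] at hw
    have iH : IntervalIntegrable H volume 0 r := (hHc.mono hsub).intervalIntegrable
    have iP : IntervalIntegrable (fun s => ∫ σ in (0:ℝ)..s, f σ) volume 0 r :=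
      (hPc.mono hsub).intervalIntegrable
    rw [intervalIntegral.integral_sub iH (iP.add intervalIntegrable_const),
      intervalIntegral.integral_add iP intervalIntegrable_const, intervalIntegral.integral_const,
      smul_eq_mul, sub_zero]
    linarith
  have : H τ - ((∫ σ in (0:ℝ)..τ, f σ) + c) = 0 := ContinuousOn.eqOn_zero_of_integral_eq_zero hτ0
    (hHc.sub (hPc.add continuousOn_const)) key τ ⟨hτ0.le, le_rfl⟩
  rw [intervalIntegral.integral_of_le hτ0.le] at this
  linarith

theorem tendsto_integral_mul_cutoff {μ : Measure ℝ} {f : ℝ → ℝ} (hf : Integrable f μ)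
    {y : ℝ → ℝ} (hy : Continuous y) (a : ℝ) :
    Tendsto (fun n : ℕ => ∫ x, f x * Real.smoothTransition (n * (a - y x)) ∂μ) atTop
      (𝓝 (∫ x, if y x < a then f x else 0 ∂μ)) := by
  refine tendsto_integral_of_dominated_convergence (fun x => |f x|) (fun n => ?_) hf.abs
    (fun n => Eventually.of_forall fun x => ?_) (Eventually.of_forall fun x => ?_)
  · exact hf.aestronglyMeasurable.mul
      (Real.smoothTransition.continuous.comp (by fun_prop)).aestronglyMeasurable
  · rw [norm_mul, Real.norm_eq_abs, Real.norm_eq_abs,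
      abs_of_nonneg (Real.smoothTransition.nonneg _)]
    exact mul_le_of_le_one_right (abs_nonneg _) (Real.smoothTransition.le_one _)
  · refine tendsto_const_nhds.congr' ?_
    split_ifs with h
    · have : Tendsto (fun n : ℕ => (n : ℝ) * (a - y x)) atTop atTop :=
        tendsto_natCast_atTop_atTop.atTop_mul_const (sub_pos.2 h)
      filter_upwards [this.eventually_ge_atTop 1] with n hn
      rw [Real.smoothTransition.one_of_one_le hn, mul_one]
    · refine Eventually.of_forall fun n => ?_
      have hn : (n : ℝ) * (a - y x) ≤ 0 :=
        mul_nonpos_of_nonneg_of_nonpos n.cast_nonneg (by linarith)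
      simp only [Real.smoothTransition.zero_of_nonpos hn, mul_zero]

/-- As long as the characteristic from the origin has not left `[0, 1]`, the total mass is the
mass that has entered plus the mass of the initial datum that has not yet left. -/
theorem IsWeakSolution.mass_eq {lam : ℝ → ℝ} {δ : ℝ}
    {ρ₀ u : ℝ → ℝ} (hρ₀ : IntegrableOn ρ₀ (Ioc 0 1)) (hu : IntegrableOn u (Ioc 0 δ))
    {ρ : ℝ → ℝ → ℝ}
    (h : IsWeakSolution lam δ ρ₀ u ρ) {X : ℝ → ℝ} (hX : ContDiff ℝ 1 X) (hXm : StrictMono X)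
    (hX0 : X 0 = 0) (hXd : ∀ t ∈ Icc 0 δ, HasDerivAt X (lam (∫ x in Ioc (0:ℝ) 1, ρ t x)) t)
    {τ : ℝ} (hτ0 : 0 < τ) (hτ : τ ≤ δ) (hXτ : X τ ≤ 1) :
    ∫ x in Ioc (0:ℝ) 1, ρ τ x = (∫ σ in (0:ℝ)..τ, u σ) + ∫ x in (0:ℝ)..(1 - X τ), ρ₀ x := by
  have hXτ0 : 0 < X τ := hX0 ▸ hXm hτ0
  have key (n : ℕ) := h.integral_mul_comp_characteristic hu hX hXm hX0 hXd
    (G := fun y => Real.smoothTransition (n * ((1 - X τ) - y))) (C := 1)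
    (Real.smoothTransition.contDiff.comp (n := 1) (by fun_prop))
    (fun y => by
      rw [abs_of_nonneg (Real.smoothTransition.nonneg _)]
      exact Real.smoothTransition.le_one _)
    hτ0 hτ (fun y hy => Real.smoothTransition.zero_of_nonpos
        (mul_nonpos_of_nonneg_of_nonpos n.cast_nonneg (by linarith)))
  have L := tendsto_integral_mul_cutoff (h.1 τ ⟨hτ0.le, hτ⟩)
    (y := fun x => x - X τ) (by fun_prop) (1 - X τ)
  have R₁ := tendsto_integral_mul_cutoff (hu.mono_set (Ioc_subset_Ioc_right hτ))
    (y := fun s => -X s) hX.continuous.neg (1 - X τ)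
  have R₂ := tendsto_integral_mul_cutoff hρ₀ (y := fun x => x) continuous_id (1 - X τ)
  have hlim := tendsto_nhds_unique L ((R₁.add R₂).congr fun n => (key n).symm)
  have ne (b : ℝ) (s : Set ℝ) : ∀ᵐ x ∂(volume.restrict s), x ≠ b :=
    ae_restrict_of_ae (Measure.ae_ne volume b)
  have eL : (∫ x in Ioc (0:ℝ) 1, if x - X τ < 1 - X τ then ρ τ x else 0)
      = ∫ x in Ioc (0:ℝ) 1, ρ τ x := by
    refine integral_congr_ae ?_
    filter_upwards [ne 1 (Ioc 0 1), ae_restrict_mem measurableSet_Ioc] with x hx hx1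
    rw [if_pos (by linarith [lt_of_le_of_ne hx1.2 hx])]
  have e₁ : (∫ s in Ioc (0:ℝ) τ, if -X s < 1 - X τ then u s else 0) = ∫ s in (0:ℝ)..τ, u s := by
    rw [intervalIntegral.integral_of_le hτ0.le]
    refine setIntegral_congr_fun measurableSet_Ioc fun s hs => ?_
    have := hX0 ▸ hXm hs.1
    exact if_pos (by linarith)
  have e₂ : (∫ x in Ioc (0:ℝ) 1, if x < 1 - X τ then ρ₀ x else 0)
      = ∫ x in (0:ℝ)..(1 - X τ), ρ₀ x := by
    rw [intervalIntegral.integral_of_le (by linarith),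
      show Ioc 0 (1 - X τ) = Ioc 0 1 ∩ Iic (1 - X τ) by
        rw [Ioc_inter_Iic, min_eq_right (by linarith)],
      ← setIntegral_indicator measurableSet_Iic]
    refine integral_congr_ae ?_
    filter_upwards [ne (1 - X τ) (Ioc 0 1)] with x hx
    simp only [indicator_apply, mem_Iic, hx.le_iff_lt]
  rw [eL, e₁] at hlim
  exact hlim.trans (congrArg _ e₂)

theorem integral_mem_Icc_of_nonneg {f : ℝ → ℝ} {a b : ℝ} (hf : IntegrableOn f (Ioc 0 b))
    (h0 : ∀ᵐ x ∂(volume.restrict (Ioc 0 b)), 0 ≤ f x) (ha : 0 ≤ a) (hab : a ≤ b) :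
    ∫ x in (0:ℝ)..a, f x ∈ Icc 0 (∫ x in (0:ℝ)..b, |f x|) := by
  have hsub : Ioc 0 a ⊆ Ioc 0 b := Ioc_subset_Ioc_right hab
  rw [intervalIntegral.integral_of_le ha, intervalIntegral.integral_of_le (ha.trans hab)]
  refine ⟨integral_nonneg_of_ae (ae_restrict_of_ae_restrict_of_subset hsub h0), ?_⟩
  calc ∫ x in Ioc 0 a, f x ≤ ∫ x in Ioc 0 a, |f x| :=
        integral_mono (hf.mono_set hsub) (hf.mono_set hsub).abs fun x => le_abs_self _
    _ ≤ ∫ x in Ioc 0 b, |f x| := setIntegral_mono_set hf.abs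
        (Eventually.of_forall fun x => abs_nonneg _) hsub.eventuallyLE

theorem lamInf_le_and_le_lamSup {lam : ℝ → ℝ} (hlam : Continuous lam) {M w : ℝ}
    (hw : w ∈ Icc 0 M) : lamInf lam M ≤ lam w ∧ lam w ≤ lamSup lam M :=
  ⟨csInf_le (isCompact_Icc.bddBelow_image hlam.continuousOn) (mem_image_of_mem _ hw),
    le_csSup (isCompact_Icc.bddAbove_image hlam.continuousOn) (mem_image_of_mem _ hw)⟩

theorem le_supNorm {δ : ℝ} {f : ℝ → ℝ} (hf : ContinuousOn f (Icc 0 δ)) {t : ℝ}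
    (ht : t ∈ Icc 0 δ) : |f t| ≤ supNorm δ f :=
  le_csSup (isCompact_Icc.bddAbove_image hf.abs) (mem_image_of_mem (fun t => |f t|) ht)

/-- Follow `X` up to time `τ`, then continue with constant speed `c`. -/
def extendLinear (X : ℝ → ℝ) (τ c : ℝ) (t : ℝ) : ℝ := X (min t τ) + c * (t - min t τ)

theorem extendLinear_of_le {X : ℝ → ℝ} {τ c t : ℝ} (h : t ≤ τ) : extendLinear X τ c t = X t := by
  simp [extendLinear, min_eq_left h]

theorem extendLinear_mem_Omega {lam X : ℝ → ℝ} {δ M τ c : ℝ} (hX : Continuous X) (hX0 : X 0 = 0)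
    (hτ0 : 0 ≤ τ) (hc : c ∈ Icc (lamInf lam M) (lamSup lam M))
    (hs : ∀ s ∈ Icc 0 τ, ∀ t ∈ Icc 0 τ, s ≤ t →
      X t - X s ∈ Icc (lamInf lam M * (t - s)) (lamSup lam M * (t - s))) :
    extendLinear X τ c ∈ Omega lam δ M := by
  refine ⟨?_, by simp [extendLinear, hτ0, hX0], fun s hsδ t htδ hst => ?_⟩
  · unfold extendLinear
    fun_prop
  · have h1 := hs (min s τ) ⟨le_min hsδ.1 hτ0, min_le_right _ _⟩ (min t τ)
      ⟨le_min htδ.1 hτ0, min_le_right _ _⟩ (min_le_min_right _ hst.le)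
    have h2 : 0 ≤ (t - min t τ) - (s - min s τ) := by
      rcases le_total s τ with h | h <;> rcases le_total t τ with h' | h' <;>
        simp only [min_eq_left h, min_eq_right h, min_eq_left h', min_eq_right h'] <;> linarith
    rw [le_div_iff₀ (sub_pos.2 hst), div_le_iff₀ (sub_pos.2 hst)]
    unfold extendLinear
    have h3 := mul_le_mul_of_nonneg_right hc.1 h2
    have h4 := mul_le_mul_of_nonneg_right hc.2 h2
    constructor <;> nlinarith [h1.1, h1.2]

/-- If `F` contracts `Ω_{δ,M}`, then two curves that solve the fixed point equation on a
subinterval `[0, τ]` coincide there. -/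
theorem eqOn_of_fixed_of_contraction {lam ρ₀ u : ℝ → ℝ} {δ M : ℝ}
    (hself : ∀ ξ ∈ Omega lam δ M, Fmap lam ρ₀ u ξ ∈ Omega lam δ M)
    (hcontr : ∀ ξ₁ ∈ Omega lam δ M, ∀ ξ₂ ∈ Omega lam δ M,
        supNorm δ (fun t => Fmap lam ρ₀ u ξ₁ t - Fmap lam ρ₀ u ξ₂ t)
          ≤ (1 / 2) * supNorm δ (fun t => ξ₁ t - ξ₂ t))
    {τ c : ℝ} (hτ0 : 0 ≤ τ) (hτ : τ ≤ δ) {X₁ X₂ : ℝ → ℝ}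
    (h₁ : extendLinear X₁ τ c ∈ Omega lam δ M) (h₂ : extendLinear X₂ τ c ∈ Omega lam δ M)
    (hF₁ : ∀ t ∈ Icc 0 τ, X₁ t = Fmap lam ρ₀ u X₁ t)
    (hF₂ : ∀ t ∈ Icc 0 τ, X₂ t = Fmap lam ρ₀ u X₂ t) :
    ∀ t ∈ Icc 0 τ, X₁ t = X₂ t := by
  set E₁ := extendLinear X₁ τ c with hE₁
  set E₂ := extendLinear X₂ τ c with hE₂
  have hloc : ∀ X : ℝ → ℝ, ∀ t ∈ Icc 0 τ,
      Fmap lam ρ₀ u (extendLinear X τ c) t = Fmap lam ρ₀ u X t := by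
    intro X t ht
    refine intervalIntegral.integral_congr fun s hs => ?_
    rw [uIcc_of_le ht.1] at hs
    simp only [extendLinear_of_le (hs.2.trans ht.2)]
  set S := supNorm δ (fun t => E₁ t - E₂ t) with hS
  have hSle : S ≤ 1 / 2 * S := by
    refine le_trans (csSup_le ⟨_, mem_image_of_mem _ ⟨le_rfl, hτ0.trans hτ⟩⟩ ?_)
      (hcontr _ h₁ _ h₂)
    rintro _ ⟨t, ht, rfl⟩
    have hm : min t τ ∈ Icc 0 τ := ⟨le_min ht.1 hτ0, min_le_right _ _⟩
    have : E₁ t - E₂ t = Fmap lam ρ₀ u E₁ (min t τ) - Fmap lam ρ₀ u E₂ (min t τ) := by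
      rw [hE₁, hE₂, hloc _ _ hm, hloc _ _ hm, ← hF₁ _ hm, ← hF₂ _ hm]
      unfold extendLinear
      ring
    simp only [this]
    exact le_supNorm ((hself _ h₁).1.sub (hself _ h₂).1) ⟨hm.1, hm.2.trans hτ⟩
  intro t ht
  have h := le_supNorm (h₁.1.sub h₂.1) (t := t) ⟨ht.1, ht.2.trans hτ⟩
  have hz : |E₁ t - E₂ t| ≤ 0 := h.trans (by change S ≤ 0; linarith)
  rw [hE₁, hE₂, extendLinear_of_le ht.2, extendLinear_of_le ht.2] at hz
  exact sub_eq_zero.1 (abs_nonpos_iff.1 hz)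

/-- Two weak solutions with the same value of the characteristic at time `τ > 0` agree at `τ`. -/
theorem IsWeakSolution.ae_eq_of_characteristic_eq {lam : ℝ → ℝ} {δ : ℝ}
    {ρ₀ u : ℝ → ℝ} (hu : IntegrableOn u (Ioc 0 δ)) {ρ₁ ρ₂ : ℝ → ℝ → ℝ}
    (h₁ : IsWeakSolution lam δ ρ₀ u ρ₁) (h₂ : IsWeakSolution lam δ ρ₀ u ρ₂) {X₁ X₂ : ℝ → ℝ}
    (hX₁ : ContDiff ℝ 1 X₁) (hXm₁ : StrictMono X₁) (hX0₁ : X₁ 0 = 0)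
    (hXd₁ : ∀ t ∈ Icc 0 δ, HasDerivAt X₁ (lam (∫ x in Ioc (0:ℝ) 1, ρ₁ t x)) t)
    (hX₂ : ContDiff ℝ 1 X₂) (hXm₂ : StrictMono X₂) (hX0₂ : X₂ 0 = 0)
    (hXd₂ : ∀ t ∈ Icc 0 δ, HasDerivAt X₂ (lam (∫ x in Ioc (0:ℝ) 1, ρ₂ t x)) t)
    {τ : ℝ} (hτ0 : 0 < τ) (hτ : τ ≤ δ) (hE : ∀ t ∈ Icc 0 τ, X₁ t = X₂ t) :
    ∀ᵐ x ∂(volume.restrict (Ioc (0:ℝ) 1)), ρ₁ τ x = ρ₂ τ x := by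
  have i₁ := h₁.1 τ ⟨hτ0.le, hτ⟩
  have i₂ := h₂.1 τ ⟨hτ0.le, hτ⟩
  have hEτ := hE τ ⟨hτ0.le, le_rfl⟩
  have hz : ∀ᵐ x ∂(volume.restrict (Ioc (0:ℝ) 1)), x ∈ Ioo (0:ℝ) 1 → ρ₁ τ x - ρ₂ τ x = 0 := by
    refine isOpen_Ioo.ae_eq_zero_of_integral_contDiff_smul_eq_zero
      ((Integrable.locallyIntegrable (i₁.sub i₂)).locallyIntegrableOn _) ?_
    intro g hg hgc hgs
    obtain ⟨C, hC⟩ := hgc.exists_bound_of_continuous hg.continuous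
    have hg1 : ∀ y, 1 - X₁ τ ≤ y → g (y + X₁ τ) = 0 := fun y hy =>
      image_eq_zero_of_notMem_tsupport fun hmem => by
        have := (hgs hmem).2
        linarith
    have hG : ContDiff ℝ 1 fun y => g (y + X₁ τ) :=
      (hg.of_le (by exact_mod_cast le_top)).comp (by fun_prop)
    have k₁ := h₁.integral_mul_comp_characteristic hu hX₁ hXm₁ hX0₁ hXd₁ hG
      (fun y => hC _) hτ0 hτ hg1
    have k₂ := h₂.integral_mul_comp_characteristic hu hX₂ hXm₂ hX0₂ hXd₂ hG
      (fun y => hC _) hτ0 hτ (by rwa [← hEτ])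
    have e : (∫ s in Ioc (0:ℝ) τ, u s * g (-X₁ s + X₁ τ))
        = ∫ s in Ioc (0:ℝ) τ, u s * g (-X₂ s + X₁ τ) :=
      setIntegral_congr_fun measurableSet_Ioc fun s hs => by
        simp only [hE s ⟨hs.1.le, hs.2⟩]
    rw [e, ← k₂, ← hEτ] at k₁
    simp only [sub_add_cancel] at k₁
    have hgm : AEStronglyMeasurable g (volume.restrict (Ioc (0:ℝ) 1)) :=
      hg.continuous.aestronglyMeasurable
    simp only [smul_eq_mul, mul_comm (g _), sub_mul]
    rw [MeasureTheory.integral_sub (i₁.mul_bdd hgm (Eventually.of_forall hC))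
      (i₂.mul_bdd hgm (Eventually.of_forall hC)), k₁, sub_self]
  filter_upwards [hz, ae_restrict_mem measurableSet_Ioc,
    ae_restrict_of_ae (Measure.ae_ne volume 1)] with x hx hx1 hx2
  exact sub_eq_zero.1 (hx ⟨hx1.1, lt_of_le_of_ne hx1.2 hx2⟩)

/-- Weak solutions that agree at positive times agree at the initial time. -/
theorem IsWeakSolution.ae_eq_zero_time {lam : ℝ → ℝ} {δ : ℝ} (hδ : 0 < δ)
    {ρ₀ u : ℝ → ℝ} {ρ₁ ρ₂ : ℝ → ℝ → ℝ}
    (h₁ : IsWeakSolution lam δ ρ₀ u ρ₁) (h₂ : IsWeakSolution lam δ ρ₀ u ρ₂)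
    (h : ∀ t ∈ Ioc 0 δ, ∀ᵐ x ∂(volume.restrict (Ioc (0:ℝ) 1)), ρ₁ t x = ρ₂ t x) :
    ∀ᵐ x ∂(volume.restrict (Ioc (0:ℝ) 1)), ρ₁ 0 x = ρ₂ 0 x := by
  have h0 : (0:ℝ) ∈ Icc 0 δ := ⟨le_rfl, hδ.le⟩
  have hlim := ((h₁.tendsto_integral_abs_sub h0).add (h₂.tendsto_integral_abs_sub h0)).mono_left
    (nhdsWithin_mono _ Ioc_subset_Icc_self : 𝓝[Ioc 0 δ] (0:ℝ) ≤ _)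
  have : (𝓝[Ioc 0 δ] (0:ℝ)).NeBot := by
    rw [nhdsWithin_Ioc_eq_nhdsGT hδ]; infer_instance
  have i := (h₁.1 0 h0).sub (h₂.1 0 h0)
  have hle : ∫ x in Ioc (0:ℝ) 1, |ρ₁ 0 x - ρ₂ 0 x| ≤ 0 + 0 := by
    refine ge_of_tendsto hlim ?_
    filter_upwards [self_mem_nhdsWithin] with t ht
    have i₁ := ((h₁.1 t (Ioc_subset_Icc_self ht)).sub (h₁.1 0 h0)).abs
    have i₂ := ((h₂.1 t (Ioc_subset_Icc_self ht)).sub (h₂.1 0 h0)).abs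
    refine le_trans (integral_mono_ae i.abs (i₁.add i₂) ?_) (MeasureTheory.integral_add i₁ i₂).le
    filter_upwards [h t ht] with x hx
    simp only [Pi.add_apply, Pi.sub_apply, hx]
    rw [abs_sub_comm (ρ₂ t x) (ρ₁ 0 x)]
    exact abs_sub_le _ _ _
  have hz := (integral_eq_zero_iff_of_nonneg (fun x => abs_nonneg _) i.abs).1
    (le_antisymm (by simpa using hle) (integral_nonneg fun x => abs_nonneg _))
  filter_upwards [hz] with x hx
  exact sub_eq_zero.1 (abs_eq_zero.1 hx)

/-- Uniqueness: if `ρ̄` is any weak solution on `[0,δ]` (with `δ` small enough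
that `ξ̄(δ) ≤ 1` and `F` is a contraction of `Ω_{δ,M}`), then its characteristic
curve `ξ̄(t) = ∫₀ᵗ λ(W̄(s)) ds` is a fixed point of `F`; consequently the weak
solution on `[0,δ]` is unique. -/
theorem weak_solution_unique_small_time
    (lam : ℝ → ℝ) (hlam : ContDiff ℝ 1 lam) (hlam_pos : ∀ w, 0 < lam w)
    (T : ℝ) (hT : 0 < T) (ρ₀ u : ℝ → ℝ)
    (hρ₀ : MeasureTheory.IntegrableOn ρ₀ (Set.Ioc 0 1))
    (hu : MeasureTheory.IntegrableOn u (Set.Ioc 0 T))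
    (hρ₀nn : ∀ᵐ x ∂(volume.restrict (Set.Ioc (0:ℝ) 1)), 0 ≤ ρ₀ x)
    (hunn : ∀ᵐ t ∂(volume.restrict (Set.Ioc (0:ℝ) T)), 0 ≤ u t)
    (M : ℝ) (hM : M = (∫ t in (0:ℝ)..T, |u t|) + ∫ x in (0:ℝ)..1, |ρ₀ x|)
    (δ : ℝ) (hδ0 : 0 < δ) (hδT : δ ≤ T)
    (ρbar : ℝ → ℝ → ℝ) (hρbar : IsWeakSolution lam δ ρ₀ u ρbar)
    (ξbar : ℝ → ℝ)
    (hξbar : ∀ t ∈ Set.Icc (0:ℝ) δ,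
        ξbar t = ∫ s in (0:ℝ)..t, lam (∫ x in Set.Ioc (0:ℝ) 1, ρbar s x))
    (hsmall : ξbar δ ≤ 1)
    (hself : ∀ ξ ∈ Omega lam δ M, Fmap lam ρ₀ u ξ ∈ Omega lam δ M)
    (hcontr : ∀ ξ₁ ∈ Omega lam δ M, ∀ ξ₂ ∈ Omega lam δ M,
        supNorm δ (fun t => Fmap lam ρ₀ u ξ₁ t - Fmap lam ρ₀ u ξ₂ t)
          ≤ (1 / 2) * supNorm δ (fun t => ξ₁ t - ξ₂ t)) :
    (∀ t ∈ Set.Icc (0:ℝ) δ, ξbar t = Fmap lam ρ₀ u ξbar t) ∧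
    ∀ ρ' : ℝ → ℝ → ℝ, IsWeakSolution lam δ ρ₀ u ρ' →
      ∀ t ∈ Set.Icc (0:ℝ) δ,
        ∀ᵐ x ∂(volume.restrict (Set.Ioc (0:ℝ) 1)), ρ' t x = ρbar t x := by
  have hlc := hlam.continuous
  have huδ : IntegrableOn u (Ioc 0 δ) := hu.mono_set (Ioc_subset_Ioc_right hδT)
  have hmassM : ∀ t ∈ Icc 0 δ, ∀ a ∈ Icc (0:ℝ) 1,
      (∫ σ in (0:ℝ)..t, u σ) + ∫ x in (0:ℝ)..a, ρ₀ x ∈ Icc 0 M := by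
    intro t ht a ha
    have h1 := integral_mem_Icc_of_nonneg hu hunn ht.1 (ht.2.trans hδT)
    have h2 := integral_mem_Icc_of_nonneg hρ₀ hρ₀nn ha.1 ha.2
    exact ⟨add_nonneg h1.1 h2.1, hM ▸ add_le_add h1.2 h2.2⟩
  have hfix : ∀ ρ : ℝ → ℝ → ℝ, IsWeakSolution lam δ ρ₀ u ρ → ∀ ξ : ℝ → ℝ, ContDiff ℝ 1 ξ →
      StrictMono ξ → ξ 0 = 0 →
      (∀ t ∈ Icc 0 δ, HasDerivAt ξ (lam (∫ x in Ioc (0:ℝ) 1, ρ t x)) t) →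
      (∀ t ∈ Icc 0 δ, ξ t = ∫ s in (0:ℝ)..t, lam (∫ x in Ioc (0:ℝ) 1, ρ s x)) →
      ∀ τ ∈ Icc 0 δ, ξ τ ≤ 1 → (∀ t ∈ Icc 0 τ, ξ t = Fmap lam ρ₀ u ξ t) ∧
        extendLinear ξ τ (lam 0) ∈ Omega lam δ M := by
    intro ρ h ξ hξ hξm hξ0 hξd hξi τ hτ hξτ
    have hmass : ∀ t ∈ Ioc 0 τ, ∫ x in Ioc (0:ℝ) 1, ρ t x
        = (∫ σ in (0:ℝ)..t, u σ) + ∫ x in (0:ℝ)..(1 - ξ t), ρ₀ x := fun t ht =>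
      h.mass_eq hρ₀ huδ hξ hξm hξ0 hξd ht.1 (ht.2.trans hτ.2) ((hξm.monotone ht.2).trans hξτ)
    have hspeed : ∀ t ∈ Ioo 0 τ, deriv ξ t ∈ Icc (lamInf lam M) (lamSup lam M) := by
      intro t ht
      have htδ : t ∈ Icc 0 δ := ⟨ht.1.le, ht.2.le.trans hτ.2⟩
      have hξt := hξ0 ▸ hξm ht.1
      rw [(hξd t htδ).deriv, hmass t ⟨ht.1, ht.2.le⟩]
      exact lamInf_le_and_le_lamSup hlc
        (hmassM t htδ _ ⟨by linarith [hξm ht.2], by linarith⟩)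
    refine ⟨fun t ht => ?_, extendLinear_mem_Omega hξ.continuous hξ0 hτ.1
      (lamInf_le_and_le_lamSup hlc (by simpa using hmassM 0 ⟨le_rfl, hδ0.le⟩ 0 (by simp)))
      fun s hs t ht hst => ⟨?_, ?_⟩⟩
    · rw [hξi t ⟨ht.1, ht.2.trans hτ.2⟩]
      refine intervalIntegral.integral_congr_ae (Eventually.of_forall fun s hs => ?_)
      rw [uIoc_of_le ht.1] at hs
      rw [hmass s ⟨hs.1, hs.2.trans ht.2⟩]
    · exact (convex_Icc 0 τ).mul_sub_le_image_sub_of_le_deriv hξ.continuous.continuousOn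
        (hξ.differentiable one_ne_zero).differentiableOn
        (fun x hx => (hspeed x (by rwa [interior_Icc] at hx)).1) s hs t ht hst
    · exact (convex_Icc 0 τ).image_sub_le_mul_sub_of_deriv_le hξ.continuous.continuousOn
        (hξ.differentiable one_ne_zero).differentiableOn
        (fun x hx => (hspeed x (by rwa [interior_Icc] at hx)).2) s hs t ht hst
  have hδm : δ ∈ Icc 0 δ := ⟨hδ0.le, le_rfl⟩
  obtain ⟨X, hX, hXm, hX0, hXd, hXi⟩ := hρbar.exists_characteristic hlc hlam_pos hδ0.le
  have hXξ : ∀ t ∈ Icc 0 δ, ξbar t = X t := fun t ht => (hξbar t ht).trans (hXi t ht).symm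
  have hXδ : X δ ≤ 1 := hXξ δ hδm ▸ hsmall
  obtain ⟨hXF, -⟩ := hfix ρbar hρbar X hX hXm hX0 hXd hXi δ hδm hXδ
  refine ⟨fun t ht => ?_, fun ρ' hρ' => ?_⟩
  · rw [hXξ t ht, hXF t ht]
    refine intervalIntegral.integral_congr fun s hs => ?_
    rw [uIcc_of_le ht.1] at hs
    simp only [hXξ s ⟨hs.1, hs.2.trans ht.2⟩]
  obtain ⟨Y, hY, hYm, hY0, hYd, hYi⟩ := hρ'.exists_characteristic hlc hlam_pos hδ0.le
  have heq : ∀ τ ∈ Icc 0 δ, Y τ ≤ 1 → ∀ t ∈ Icc 0 τ, Y t = X t := fun τ hτ hYτ => by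
    obtain ⟨hF₁, hΩ₁⟩ := hfix ρ' hρ' Y hY hYm hY0 hYd hYi τ hτ hYτ
    obtain ⟨hF₂, hΩ₂⟩ := hfix ρbar hρbar X hX hXm hX0 hXd hXi τ hτ
      ((hXm.monotone hτ.2).trans hXδ)
    exact eqOn_of_fixed_of_contraction hself hcontr hτ.1 hτ.2 hΩ₁ hΩ₂ hF₁ hF₂
  have hYδ : Y δ ≤ 1 := by
    by_contra! hlt
    obtain ⟨τ, hτ, hYτ⟩ := intermediate_value_Icc hδ0.le hY.continuous.continuousOn
      (show (1:ℝ) ∈ Icc (Y 0) (Y δ) from ⟨by rw [hY0]; exact zero_le_one, hlt.le⟩)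
    have hτδ : τ < δ := hYm.lt_iff_lt.1 (hYτ.trans_lt hlt)
    have := heq τ hτ hYτ.le τ ⟨hτ.1, le_rfl⟩
    linarith [hXm hτδ]
  have hpos : ∀ t ∈ Ioc 0 δ, ∀ᵐ x ∂(volume.restrict (Ioc (0:ℝ) 1)), ρ' t x = ρbar t x :=
    fun t ht => hρ'.ae_eq_of_characteristic_eq huδ hρbar hY hYm hY0 hYd hX hXm hX0 hXd ht.1 ht.2
      fun s hs => heq δ hδm hYδ s ⟨hs.1, hs.2.trans ht.2⟩
  intro t ht
  rcases ht.1.eq_or_lt with rfl | h0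
  · exact hρ'.ae_eq_zero_time hδ0 hρbar hpos
  · exact hpos t ⟨h0, ht.2⟩
end
end
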